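/- arXiv:2005.03269 — 2 statements merged into one kernel-verified Lean document; each statement's English description precedes it below -/
import Mathlib

section
/- For every point x of the homogeneous Cantor set E with unique coding (d_i), the pointwise lower s-density of μ at x equals Θ_*^s(μ,x) = 2^{-s} · (R/ρ − liminf_{n→∞} γ_n(x))^{-s}, where γ_n(x) := T^n x if d_n = 0, γ_n(x) := max{T^n x, 1 − T^n x} if 1 ≤ d_n ≤ N−2, and γ_n(x) := 1 − T^n x if d_n = N−1. -/
open MeasureTheory Filter Set Topology ENNReal

namespace HomogeneousCantorDensity

noncomputable def R (N : ℕ) (ρ : ℝ) : ℝ := (1 - ρ) / ((N : ℝ) - 1)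

noncomputable def f (N : ℕ) (ρ : ℝ) (i : ℕ) (x : ℝ) : ℝ := ρ * x + (i : ℝ) * R N ρ

noncomputable def piMap (N : ℕ) (ρ : ℝ) (d : ℕ → ℕ) : ℝ :=
  R N ρ * ∑' i : ℕ, (d i : ℝ) * ρ ^ i

def cantorE (N : ℕ) (ρ : ℝ) : Set ℝ :=
  {x | ∃ d : ℕ → ℕ, (∀ i, d i < N) ∧ x = piMap N ρ d}

/-- `μ = ∑_{i=0}^{N-1} (1/N) μ ∘ f_i⁻¹`. -/
def IsSelfSimilar (N : ℕ) (ρ : ℝ) (μ : Measure ℝ) : Prop :=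
  μ = ∑ i ∈ Finset.range N, (N : ℝ≥0∞)⁻¹ • μ.map (f N ρ i)

/-- `T^n x` for `x = piMap N ρ d`. -/
noncomputable def Tn (N : ℕ) (ρ : ℝ) (d : ℕ → ℕ) (n : ℕ) : ℝ :=
  piMap N ρ (fun i => d (n + i))

/-- pointwise lower `s`-density of `μ` at `x`. -/
noncomputable def lowerDensity (μ : Measure ℝ) (s x : ℝ) : ℝ :=
  liminf (fun r : ℝ => (μ (Ioo (x - r) (x + r))).toReal / (2 * r) ^ s) (𝓝[>] 0)

/-- pointwise upper `s`-density of `μ` at `x`. -/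
noncomputable def upperDensity (μ : Measure ℝ) (s x : ℝ) : ℝ :=
  limsup (fun r : ℝ => (μ (Ioo (x - r) (x + r))).toReal / (2 * r) ^ s) (𝓝[>] 0)

section helpers

variable {N : ℕ} {ρ : ℝ} {μ : Measure ℝ}

lemma N_ge (hN : 2 ≤ N) : (2 : ℝ) ≤ N := by exact_mod_cast hN

lemma Nsq (hN : 2 ≤ N) (hρ1 : ρ ≤ 1 / (N : ℝ) ^ 2) : ρ * (N : ℝ) ^ 2 ≤ 1 := by
  have h := N_ge hN
  rwa [le_div_iff₀ (by positivity)] at hρ1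

lemma rho_le (hN : 2 ≤ N) (hρ0 : 0 < ρ) (hρ1 : ρ ≤ 1 / (N : ℝ) ^ 2) : ρ ≤ 1 / 4 := by
  have h := N_ge hN
  have h2 := Nsq hN hρ1
  nlinarith [mul_le_mul_of_nonneg_left (show (4 : ℝ) ≤ (N : ℝ) ^ 2 by nlinarith) hρ0.le]

lemma K_ge (hN : 2 ≤ N) (hρ0 : 0 < ρ) (hρ1 : ρ ≤ 1 / (N : ℝ) ^ 2) :
    (N : ℝ) + 1 ≤ R N ρ / ρ := by
  have h := N_ge hN
  have h2 := Nsq hN hρ1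
  unfold R
  rw [le_div_iff₀ hρ0, le_div_iff₀ (by linarith)]
  nlinarith

lemma R_mul (hN : 2 ≤ N) : R N ρ * ((N : ℝ) - 1) = 1 - ρ := by
  have h := N_ge hN
  unfold R
  rw [div_mul_cancel₀]
  linarith

lemma measurable_f (i : ℕ) : Measurable (f N ρ i) := by
  unfold f
  fun_prop

lemma real_ss [IsProbabilityMeasure μ] (hss : IsSelfSimilar N ρ μ) {A : Set ℝ}
    (hA : MeasurableSet A) :
    μ.real A = (N : ℝ)⁻¹ * ∑ i ∈ Finset.range N, μ.real (f N ρ i ⁻¹' A) := by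
  have h1 : μ A = ∑ i ∈ Finset.range N, (N : ℝ≥0∞)⁻¹ * μ (f N ρ i ⁻¹' A) := by
    conv_lhs => rw [hss]
    rw [Measure.finsetSum_apply]
    refine Finset.sum_congr rfl fun i _ => ?_
    rw [Measure.smul_apply, Measure.map_apply (measurable_f i) hA, smul_eq_mul]
  rcases Nat.eq_zero_or_pos N with h0 | h0
  · subst h0
    simp [measureReal_def, h1]
  rw [measureReal_def, h1, ENNReal.toReal_sum, Finset.mul_sum]
  · refine Finset.sum_congr rfl fun i _ => ?_
    rw [ENNReal.toReal_mul, measureReal_def]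
    simp
  · intro i _
    refine ENNReal.mul_ne_top ?_ (measure_ne_top _ _)
    simp; omega

lemma supp_step [IsProbabilityMeasure μ] (hN : 2 ≤ N) (hρ0 : 0 < ρ) (hρ1 : ρ ≤ 1 / (N : ℝ) ^ 2)
    (hss : IsSelfSimilar N ρ μ) (c : ℝ) :
    μ.real (Icc (-c) (1 + c)) ≤ μ.real (Icc (-(ρ * c)) (1 + ρ * c)) := by
  have h := N_ge hN
  have hr := rho_le hN hρ0 hρ1
  have hRm := R_mul (ρ := ρ) hN
  have hR : 0 ≤ R N ρ := by
    unfold R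
    exact div_nonneg (by linarith) (by linarith)
  rw [real_ss hss (A := Icc (-(ρ * c)) (1 + ρ * c)) measurableSet_Icc]
  have : ∑ i ∈ Finset.range N, μ.real (Icc (-c) (1 + c)) ≤
      ∑ i ∈ Finset.range N, μ.real (f N ρ i ⁻¹' Icc (-(ρ * c)) (1 + ρ * c)) := by
    refine Finset.sum_le_sum fun i hi => measureReal_mono ?_
    intro x hx
    have hi' : (i : ℝ) ≤ N - 1 := by
      have : i + 1 ≤ N := Finset.mem_range.1 hi
      have : (i : ℝ) + 1 ≤ N := by exact_mod_cast this
      linarith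
    have h1 : (i : ℝ) * R N ρ ≤ 1 - ρ := by
      rw [← hRm, mul_comm]
      exact mul_le_mul_of_nonneg_left hi' hR
    have h2 : 0 ≤ (i : ℝ) * R N ρ := by positivity
    simp only [mem_preimage, f, mem_Icc] at hx ⊢
    constructor <;> nlinarith [hx.1, hx.2]
  rw [Finset.sum_const, Finset.card_range, nsmul_eq_mul] at this
  calc μ.real (Icc (-c) (1 + c)) = (N : ℝ)⁻¹ * (N * μ.real (Icc (-c) (1 + c))) := by
        field_simp
    _ ≤ _ := by gcongr

lemma supp [IsProbabilityMeasure μ] (hN : 2 ≤ N) (hρ0 : 0 < ρ) (hρ1 : ρ ≤ 1 / (N : ℝ) ^ 2)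
    (hss : IsSelfSimilar N ρ μ) : μ.real (Icc 0 1) = 1 := by
  have hr := rho_le hN hρ0 hρ1
  have hpow : ∀ (c : ℝ) (k : ℕ),
      μ.real (Icc (-c) (1 + c)) ≤ μ.real (Icc (-(ρ ^ k * c)) (1 + ρ ^ k * c)) := by
    intro c k
    induction k with
    | zero => simp
    | succ k ih =>
      refine ih.trans ((supp_step hN hρ0 hρ1 hss _).trans (le_of_eq ?_))
      rw [pow_succ', mul_assoc]
  have hle : ∀ n : ℕ, μ.real (Icc (-(n : ℝ)) (1 + n)) ≤ μ.real (Icc 0 1) := by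
    intro n
    have hI : (⋂ k : ℕ, Icc (-(ρ ^ k * (n : ℝ))) (1 + ρ ^ k * n)) = Icc 0 1 := by
      have ht : Tendsto (fun k : ℕ => ρ ^ k * (n : ℝ)) atTop (𝓝 0) := by
        simpa using (tendsto_pow_atTop_nhds_zero_of_lt_one hρ0.le (by linarith)).mul_const (n : ℝ)
      ext x
      simp only [mem_iInter, mem_Icc]
      constructor
      · intro hx
        constructor
        · have := ge_of_tendsto' (b := (0 : ℝ)) (a := x) (x := atTop) (f := fun k : ℕ => x + ρ ^ k * (n : ℝ)) (by simpa using ht.const_add x)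
            (fun k => by linarith [(hx k).1])
          exact this
        · have := ge_of_tendsto' (b := x) (x := atTop) (f := fun k : ℕ => 1 + ρ ^ k * (n : ℝ)) (by simpa using ht.const_add 1)
            (fun k => (hx k).2)
          exact this
      · intro hx k
        have : 0 ≤ ρ ^ k * (n : ℝ) := by positivity
        constructor <;> linarith [hx.1, hx.2]
    have hanti : Antitone fun k : ℕ => Icc (-(ρ ^ k * (n : ℝ))) (1 + ρ ^ k * n) := by
      intro a b hab
      have : ρ ^ b * (n : ℝ) ≤ ρ ^ a * n :=
        mul_le_mul_of_nonneg_right (pow_le_pow_of_le_one hρ0.le (by linarith) hab) (by positivity)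
      exact Icc_subset_Icc (by linarith) (by linarith)
    have ht := tendsto_measure_iInter_atTop (μ := μ) (fun k => measurableSet_Icc.nullMeasurableSet)
      hanti ⟨0, measure_ne_top _ _⟩
    rw [hI] at ht
    have ht' := (ENNReal.tendsto_toReal (measure_ne_top μ (Icc 0 1))).comp ht
    exact ge_of_tendsto' ht' (fun k => hpow n k)
  have hU : (⋃ n : ℕ, Icc (-(n : ℝ)) (1 + n)) = univ := by
    refine eq_univ_of_forall fun x => ?_
    obtain ⟨n, hn⟩ := exists_nat_ge |x|
    refine mem_iUnion.2 ⟨n, ?_⟩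
    have := abs_le.1 hn
    exact ⟨this.1, by linarith [this.2]⟩
  have hmono : Monotone fun n : ℕ => Icc (-(n : ℝ)) (1 + n) := by
    intro a b hab
    have : (a : ℝ) ≤ b := by exact_mod_cast hab
    exact Icc_subset_Icc (by linarith) (by linarith)
  have ht := tendsto_measure_iUnion_atTop (μ := μ) hmono
  rw [hU] at ht
  have ht' := (ENNReal.tendsto_toReal (measure_ne_top μ univ)).comp ht
  have h1 := le_of_tendsto' ht' hle
  rw [measure_univ] at h1
  exact le_antisymm measureReal_le_one (by simpa using h1)

lemma full_of [IsProbabilityMeasure μ] (hsupp : μ.real (Icc 0 1) = 1) {a b : ℝ} (ha : a < 0)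
    (hb : 1 < b) : μ.real (Ioo a b) = 1 := by
  refine le_antisymm measureReal_le_one ?_
  rw [← hsupp]
  refine measureReal_mono ?_
  intro x hx
  exact ⟨lt_of_lt_of_le ha hx.1, lt_of_le_of_lt hx.2 hb⟩

lemma null_of [IsProbabilityMeasure μ] (hsupp : μ.real (Icc 0 1) = 1) {a b : ℝ}
    (h : b ≤ 0 ∨ 1 ≤ a) : μ.real (Ioo a b) = 0 := by
  have hc : μ.real (Icc 0 1)ᶜ = 0 := by
    rw [measureReal_compl measurableSet_Icc, hsupp]
    simp
  refine le_antisymm ?_ measureReal_nonneg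
  rw [← hc]
  refine measureReal_mono ?_
  rintro x ⟨hx1, hx2⟩ ⟨h1, h2⟩
  rcases h with h | h <;> linarith

lemma edge_left [IsProbabilityMeasure μ] (hN : 2 ≤ N) (hρ0 : 0 < ρ) (hss : IsSelfSimilar N ρ μ)
    (hsupp : μ.real (Icc 0 1) = 1) (k : ℕ) : ((N : ℝ)⁻¹) ^ k ≤ μ.real (Icc 0 (ρ ^ k)) := by
  induction k with
  | zero => simp [hsupp]
  | succ k ih =>
    rw [real_ss hss measurableSet_Icc, pow_succ']
    gcongr
    refine ih.trans ?_
    have hsub : μ.real (Icc 0 (ρ ^ k)) ≤ μ.real (f N ρ 0 ⁻¹' Icc 0 (ρ ^ (k + 1))) := by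
      refine measureReal_mono ?_
      intro x hx
      simp only [mem_preimage, f, mem_Icc, Nat.cast_zero, zero_mul, add_zero] at hx ⊢
      rw [pow_succ']
      exact ⟨mul_nonneg hρ0.le hx.1, mul_le_mul_of_nonneg_left hx.2 hρ0.le⟩
    refine hsub.trans ?_
    exact Finset.single_le_sum (f := fun i => μ.real (f N ρ i ⁻¹' Icc 0 (ρ ^ (k + 1))))
      (fun i _ => measureReal_nonneg) (Finset.mem_range.2 (by omega))

lemma edge_right [IsProbabilityMeasure μ] (hN : 2 ≤ N) (hρ0 : 0 < ρ) (hss : IsSelfSimilar N ρ μ)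
    (hsupp : μ.real (Icc 0 1) = 1) (k : ℕ) : ((N : ℝ)⁻¹) ^ k ≤ μ.real (Icc (1 - ρ ^ k) 1) := by
  induction k with
  | zero => simp [hsupp]
  | succ k ih =>
    rw [real_ss hss measurableSet_Icc, pow_succ']
    gcongr
    refine ih.trans ?_
    have hsub : μ.real (Icc (1 - ρ ^ k) 1) ≤
        μ.real (f N ρ (N - 1) ⁻¹' Icc (1 - ρ ^ (k + 1)) 1) := by
      refine measureReal_mono ?_
      intro x hx
      have hR := R_mul (ρ := ρ) hN
      simp only [mem_preimage, f, mem_Icc] at hx ⊢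
      rw [Nat.cast_sub (by omega), Nat.cast_one, mul_comm ((N : ℝ) - 1), hR]
      rw [pow_succ']
      constructor <;> nlinarith [hx.1, hx.2]
    refine hsub.trans ?_
    exact Finset.single_le_sum
      (f := fun i => μ.real (f N ρ i ⁻¹' Icc (1 - ρ ^ (k + 1)) 1))
      (fun i _ => measureReal_nonneg) (Finset.mem_range.2 (by omega))

lemma exists_scale (hρ0 : 0 < ρ) (hρ1 : ρ < 1) {v : ℝ} (hv : 0 < v) (hv1 : v ≤ 1) :
    ∃ k : ℕ, ρ ^ (k + 1) < v ∧ v ≤ ρ ^ k :=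
  exists_nat_pow_near_of_lt_one hv hv1 hρ0 hρ1

lemma pow_bound (hN : 2 ≤ N) (hρ0 : 0 < ρ) (hρ1 : ρ ≤ 1 / (N : ℝ) ^ 2) {v : ℝ} {k : ℕ}
    (hv : v ≤ ρ ^ k) : v / N ≤ ((N : ℝ)⁻¹) ^ (k + 1) := by
  have h := N_ge hN
  have h2 := Nsq hN hρ1
  have : ρ ≤ (N : ℝ)⁻¹ := by
    rw [← one_div, le_div_iff₀ (by linarith)]
    nlinarith
  rw [pow_succ, div_eq_mul_inv]
  gcongr
  exact hv.trans (pow_le_pow_left₀ hρ0.le this k)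

lemma lin_left [IsProbabilityMeasure μ] (hN : 2 ≤ N) (hρ0 : 0 < ρ) (hρ1 : ρ ≤ 1 / (N : ℝ) ^ 2)
    (hss : IsSelfSimilar N ρ μ) (hsupp : μ.real (Icc 0 1) = 1) {a v : ℝ} (ha : a < 0)
    (hv : 0 ≤ v) (hv1 : v ≤ 1) : v / N ≤ μ.real (Ioo a v) := by
  rcases hv.eq_or_lt with h | h
  · rw [← h, zero_div]; exact measureReal_nonneg
  obtain ⟨k, hk1, hk2⟩ := exists_scale hρ0 (by linarith [rho_le hN hρ0 hρ1]) h hv1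
  refine (pow_bound hN hρ0 hρ1 hk2).trans ((edge_left hN hρ0 hss hsupp _).trans ?_)
  refine measureReal_mono ?_
  intro x hx
  exact ⟨lt_of_lt_of_le ha hx.1, lt_of_le_of_lt hx.2 hk1⟩

lemma lin_right [IsProbabilityMeasure μ] (hN : 2 ≤ N) (hρ0 : 0 < ρ) (hρ1 : ρ ≤ 1 / (N : ℝ) ^ 2)
    (hss : IsSelfSimilar N ρ μ) (hsupp : μ.real (Icc 0 1) = 1) {b v : ℝ} (hb : 1 < b)
    (hv : 0 ≤ v) (hv1 : v ≤ 1) : v / N ≤ μ.real (Ioo (1 - v) b) := by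
  rcases hv.eq_or_lt with h | h
  · rw [← h, zero_div]; exact measureReal_nonneg
  obtain ⟨k, hk1, hk2⟩ := exists_scale hρ0 (by linarith [rho_le hN hρ0 hρ1]) h hv1
  refine (pow_bound hN hρ0 hρ1 hk2).trans ((edge_right hN hρ0 hss hsupp _).trans ?_)
  refine measureReal_mono ?_
  intro x hx
  exact ⟨by linarith [hx.1], lt_of_le_of_lt hx.2 hb⟩

/-- measure of the ball -/
noncomputable def ball (μ : Measure ℝ) (x r : ℝ) : ℝ := μ.real (Ioo (x - r) (x + r))

lemma ball_nonneg (x r : ℝ) : 0 ≤ ball μ x r := measureReal_nonneg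

lemma ball_ss [IsProbabilityMeasure μ] (hρ0 : 0 < ρ) (hss : IsSelfSimilar N ρ μ) (i : ℕ)
    (t u : ℝ) : ball μ (f N ρ i t) (ρ * u) =
      (N : ℝ)⁻¹ * ∑ j ∈ Finset.range N, ball μ (t + ((i : ℝ) - j) * (R N ρ / ρ)) u := by
  unfold ball
  rw [real_ss hss measurableSet_Ioo]
  congr 1
  refine Finset.sum_congr rfl fun j _ => ?_
  congr 1
  have hK : R N ρ = ρ * (R N ρ / ρ) := by field_simp
  generalize R N ρ / ρ = K at hK
  ext x
  simp only [f, mem_preimage, mem_Ioo]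
  rw [hK]
  constructor
  · rintro ⟨h1, h2⟩
    constructor
    · refine lt_of_mul_lt_mul_left ?_ hρ0.le
      linarith
    · refine lt_of_mul_lt_mul_left ?_ hρ0.le
      linarith
  · rintro ⟨h1, h2⟩
    have h1 := mul_lt_mul_of_pos_left h1 hρ0
    have h2 := mul_lt_mul_of_pos_left h2 hρ0
    constructor <;> linarith

/-- If only child `i` is charged. -/
lemma ball_scale [IsProbabilityMeasure μ] (hN : 2 ≤ N) (hρ0 : 0 < ρ) (hρ1 : ρ ≤ 1 / (N : ℝ) ^ 2)
    (hss : IsSelfSimilar N ρ μ) (hsupp : μ.real (Icc 0 1) = 1) {i : ℕ} (hi : i < N)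
    {t u : ℝ} (hR : i + 1 < N → u ≤ R N ρ / ρ - t)
    (hL : 1 ≤ i → u ≤ R N ρ / ρ - (1 - t)) :
    ball μ (f N ρ i t) (ρ * u) = (N : ℝ)⁻¹ * ball μ t u := by
  have hK := K_ge hN hρ0 hρ1
  have h := N_ge hN
  rw [ball_ss hρ0 hss, Finset.sum_eq_single i]
  · simp
  · intro j hj hji
    have hj := Finset.mem_range.1 hj
    refine null_of hsupp ?_
    rcases lt_or_gt_of_ne hji with hlt | hgt
    · right
      have : (j : ℝ) + 1 ≤ i := by exact_mod_cast hlt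
      have := hL (by omega)
      nlinarith
    · left
      have : (i : ℝ) + 1 ≤ j := by exact_mod_cast hgt
      have := hR (by omega)
      nlinarith
  · intro h
    exact absurd (Finset.mem_range.2 hi) h

lemma s_facts (hN : 2 ≤ N) (hρ0 : 0 < ρ) (hρ1 : ρ ≤ 1 / (N : ℝ) ^ 2) {s : ℝ}
    (hs : s = -Real.log N / Real.log ρ) : 0 ≤ s ∧ s ≤ 1 / 2 ∧ ρ ^ s = (N : ℝ)⁻¹ := by
  have h := N_ge hN
  have hr := rho_le hN hρ0 hρ1
  have hlr : Real.log ρ < 0 := Real.log_neg hρ0 (by linarith)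
  have hlN : 0 < Real.log N := Real.log_pos (by linarith)
  have hle : Real.log ρ ≤ - (2 * Real.log N) := by
    have := Real.log_le_log hρ0 hρ1
    rw [one_div, Real.log_inv, Real.log_pow] at this
    exact_mod_cast this
  refine ⟨?_, ?_, ?_⟩
  · rw [hs]
    exact div_nonneg_of_nonpos (by linarith) hlr.le
  · rw [hs, div_le_iff_of_neg hlr]
    linarith
  · rw [Real.rpow_def_of_pos hρ0, hs, mul_div_cancel₀ _ hlr.ne, Real.exp_neg, Real.exp_log]
    linarith

lemma pow_count {s K u a : ℝ} {m : ℕ} (hm : 2 ≤ m) (hs0 : 0 ≤ s) (hs1 : s ≤ 1 / 2)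
    (hK : 3 ≤ K) (hu0 : 0 ≤ u) (hu : u ≤ m * K + 1) (ha : K - 1 ≤ a) : (u / a) ^ s ≤ m := by
  have hm' : (2 : ℝ) ≤ m := by exact_mod_cast hm
  have h1 : u / a ≤ (m : ℝ) ^ 2 := by
    rw [div_le_iff₀ (by linarith)]
    have : (m : ℝ) ^ 2 * (K - 1) ≤ (m : ℝ) ^ 2 * a := by gcongr
    nlinarith [mul_nonneg (show (0 : ℝ) ≤ m * (m - 1) by nlinarith) (show 0 ≤ K - 3 by linarith)]
  calc (u / a) ^ s ≤ ((m : ℝ) ^ 2) ^ s := by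
        apply Real.rpow_le_rpow (div_nonneg hu0 (by linarith)) h1 hs0
    _ ≤ ((m : ℝ) ^ 2) ^ (1 / 2 : ℝ) := by
        apply Real.rpow_le_rpow_of_exponent_le _ hs1
        nlinarith
    _ = m := by
        rw [← Real.sqrt_eq_rpow, Real.sqrt_sq (by linarith)]

lemma sum_ge_card {p : ℕ → ℝ} (hp : ∀ j, 0 ≤ p j) (S : Finset ℕ) (hS : S ⊆ Finset.range N)
    (h1 : ∀ j ∈ S, p j = 1) : (S.card : ℝ) ≤ ∑ j ∈ Finset.range N, p j := by
  calc (S.card : ℝ) = ∑ j ∈ S, p j := by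
        rw [Finset.sum_congr rfl h1]; simp
    _ ≤ _ := Finset.sum_le_sum_of_subset_of_nonneg hS (fun j _ _ => hp j)

/-- Main local lower bound. -/
lemma lower_local [IsProbabilityMeasure μ] (hN : 2 ≤ N) (hρ0 : 0 < ρ)
    (hρ1 : ρ ≤ 1 / (N : ℝ) ^ 2) {s : ℝ} (hs : s = -Real.log N / Real.log ρ)
    (hss : IsSelfSimilar N ρ μ) (hsupp : μ.real (Icc 0 1) = 1) {i : ℕ} (hi : i < N)
    {t u g : ℝ} (ht0 : 0 ≤ t) (ht1 : t ≤ 1) (hu : 1 < u) (hu1 : u ≤ 1 / ρ)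
    (hg : (g = t ∧ i + 1 < N) ∨ (g = 1 - t ∧ 1 ≤ i)) :
    (u / (R N ρ / ρ - g)) ^ s ≤
      ∑ j ∈ Finset.range N, ball μ (t + ((i : ℝ) - j) * (R N ρ / ρ)) u := by
  have hK := K_ge hN hρ0 hρ1
  have hRm := R_mul (ρ := ρ) hN
  have h := N_ge hN
  have hr := rho_le hN hρ0 hρ1
  obtain ⟨hs0, hs1, hρs⟩ := s_facts hN hρ0 hρ1 hs
  have hKN : R N ρ / ρ * ((N : ℝ) - 1) = 1 / ρ - 1 := by
    field_simp
    linarith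
  generalize R N ρ / ρ = K at *
  set p : ℕ → ℝ := fun j => ball μ (t + ((i : ℝ) - j) * K) u with hp
  have hp0 : ∀ j, 0 ≤ p j := fun j => ball_nonneg _ _
  have hg01 : 0 ≤ g ∧ g ≤ 1 := by
    rcases hg with hg | hg <;> constructor <;> linarith [hg.1]
  have ha : K - 1 ≤ K - g := by linarith [hg01.2]
  have hpi : p i = 1 := by
    apply full_of hsupp <;> simp <;> linarith
  have hi' : (i : ℝ) + 1 ≤ N := by exact_mod_cast hi
  have hi0 : (0 : ℝ) ≤ i := by positivity
  have hpR : ∀ j : ℕ, i ≤ j → 1 < t - ((j : ℝ) - i) * K + u → p j = 1 := by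
    intro j hj h1
    have hj : (i : ℝ) ≤ j := by exact_mod_cast hj
    apply full_of hsupp
    · nlinarith
    · linarith
  have hpL : ∀ j : ℕ, j ≤ i → t + ((i : ℝ) - j) * K - u < 0 → p j = 1 := by
    intro j hj h1
    have hj : (j : ℝ) ≤ i := by exact_mod_cast hj
    apply full_of hsupp
    · linarith
    · nlinarith
  -- below the gap
  rcases lt_or_ge u (K - g) with hlt | hge
  · calc (u / (K - g)) ^ s ≤ 1 := by
          apply Real.rpow_le_one _ _ hs0
          · exact div_nonneg (by linarith) (by linarith)
          · rw [div_le_one (by linarith)]; exact hlt.le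
      _ = p i := hpi.symm
      _ ≤ _ := Finset.single_le_sum (f := p) (fun j _ => hp0 j) (Finset.mem_range.2 hi)
  -- neighbour
  have hnb : ∃ j, j < N ∧ j ≠ i ∧ (u - (K - g) ≤ 1 → (u - (K - g)) / N ≤ p j) ∧
      (1 < u - (K - g) → p j = 1) := by
    rcases hg with ⟨hg, hi1⟩ | ⟨hg, hi1⟩
    · refine ⟨i + 1, hi1, by omega, fun hv => ?_, fun hv => ?_⟩
      · have := lin_left hN hρ0 hρ1 hss hsupp (a := t - K - u) (v := u - (K - g)) (by linarith)
          (by linarith) hv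
        refine this.trans (le_of_eq ?_)
        simp only [hp, ball]
        push_cast
        congr 2 <;> linarith
      · apply hpR _ (by omega)
        push_cast
        linarith
    · have hc : ((i - 1 : ℕ) : ℝ) = i - 1 := by
        rw [Nat.cast_sub hi1]; simp
      refine ⟨i - 1, by omega, by omega, fun hv => ?_, fun hv => ?_⟩
      · have := lin_right hN hρ0 hρ1 hss hsupp (b := t + K + u) (v := u - (K - g)) (by linarith)
          (by linarith) hv
        refine this.trans (le_of_eq ?_)
        simp only [hp, ball]
        rw [hc]
        congr 2 <;> linarith
      · apply hpL _ (by omega)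
        rw [hc]
        linarith
  obtain ⟨j, hjN, hji, hj1, hj2⟩ := hnb
  have htwo : p i + p j ≤ ∑ j ∈ Finset.range N, p j := by
    rw [← Finset.sum_pair (f := p) hji.symm]
    refine Finset.sum_le_sum_of_subset_of_nonneg ?_ (fun j _ _ => hp0 j)
    intro x hx
    simp only [Finset.mem_insert, Finset.mem_singleton] at hx
    rw [Finset.mem_range]
    omega
  rcases le_or_gt (u - (K - g)) 1 with hv | hv
  · refine le_trans ?_ htwo
    rw [hpi]
    refine le_trans ?_ (add_le_add_right (hj1 hv) 1)
    have hbase : u / (K - g) ≤ 1 + (u - (K - g)) / N := by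
      have e : u / (K - g) = 1 + (u - (K - g)) / (K - g) := by
        have : K - g ≠ 0 := by linarith
        field_simp
        ring
      rw [e]
      have : (u - (K - g)) / (K - g) ≤ (u - (K - g)) / N :=
        div_le_div_of_nonneg_left (by linarith) (by linarith) (by linarith)
      linarith
    have h1 : 1 ≤ u / (K - g) := by
      rw [le_div_iff₀ (by linarith)]; linarith
    calc (u / (K - g)) ^ s ≤ (u / (K - g)) ^ (1 : ℝ) :=
          Real.rpow_le_rpow_of_exponent_le h1 (by linarith)
      _ = u / (K - g) := Real.rpow_one _
      _ ≤ _ := hbase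
  have hp2 : (2 : ℝ) ≤ ∑ j ∈ Finset.range N, p j := by
    have := hj2 hv
    linarith
  have hmain : ∀ m : ℕ, 1 ≤ m → u ≤ m * K + 1 → (m : ℝ) ≤ ∑ j ∈ Finset.range N, p j →
      (u / (K - g)) ^ s ≤ ∑ j ∈ Finset.range N, p j := by
    intro m hm hum hsum
    rcases Nat.lt_or_ge m 2 with h2 | h2
    · have : m = 1 := by omega
      subst this
      refine le_trans (pow_count (K := K) (m := 2) le_rfl hs0 hs1 (by linarith) (by linarith) ?_ ha)
        (by exact_mod_cast hp2)
      push_cast at hum ⊢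
      linarith
    · exact (pow_count h2 hs0 hs1 (by linarith) (by linarith) hum ha).trans hsum
  by_cases hcR : t + u ≤ ((N : ℝ) - 1 - i) * K + 1
  · have hex : ∃ m : ℕ, t + u ≤ m * K + 1 := by
      refine ⟨N - 1 - i, ?_⟩
      rw [Nat.cast_sub (by omega), Nat.cast_sub (by omega)]
      simpa using hcR
    classical
    set m := Nat.find hex with hm
    have hmle : m ≤ N - 1 - i := by
      apply Nat.find_min' hex
      rw [Nat.cast_sub (by omega), Nat.cast_sub (by omega)]
      simpa using hcR
    have hmsp : t + u ≤ m * K + 1 := Nat.find_spec hex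
    have hm1 : 1 ≤ m := by
      by_contra h0
      have h0 : m = 0 := by omega
      rw [h0] at hmsp
      simp at hmsp
      linarith
    refine hmain m hm1 (by linarith) ?_
    have := sum_ge_card (N := N) hp0 (Finset.Ico i (i + m)) ?_ ?_
    · simpa using this
    · intro x hx
      rw [Finset.mem_Ico] at hx
      rw [Finset.mem_range]
      omega
    · intro x hx
      rw [Finset.mem_Ico] at hx
      refine hpR x hx.1 ?_
      have hnot := Nat.find_min hex (m := x - i) (by omega)
      rw [not_le, Nat.cast_sub hx.1] at hnot
      linarith
  by_cases hcL : 1 - t + u ≤ (i : ℝ) * K + 1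
  · have hex : ∃ m : ℕ, 1 - t + u ≤ m * K + 1 := ⟨i, hcL⟩
    classical
    set m := Nat.find hex with hm
    have hmle : m ≤ i := Nat.find_min' hex hcL
    have hmsp : 1 - t + u ≤ m * K + 1 := Nat.find_spec hex
    have hm1 : 1 ≤ m := by
      by_contra h0
      have h0 : m = 0 := by omega
      rw [h0] at hmsp
      simp at hmsp
      linarith
    refine hmain m hm1 (by linarith) ?_
    have := sum_ge_card (N := N) hp0 (Finset.Ioc (i - m) i) ?_ ?_
    · simpa [Nat.sub_sub_self hmle] using this
    · intro x hx
      rw [Finset.mem_Ioc] at hx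
      rw [Finset.mem_range]
      omega
    · intro x hx
      rw [Finset.mem_Ioc] at hx
      refine hpL x hx.2 ?_
      have hnot := Nat.find_min hex (m := i - x) (by omega)
      rw [not_le, Nat.cast_sub hx.2] at hnot
      linarith
  -- everything is covered
  push Not at hcR hcL
  have hall := sum_ge_card (N := N) hp0 (Finset.range N) subset_rfl ?_
  · rw [Finset.card_range] at hall
    refine le_trans ?_ hall
    calc (u / (K - g)) ^ s ≤ (1 / ρ) ^ s := by
          apply Real.rpow_le_rpow (div_nonneg (by linarith) (by linarith)) _ hs0
          refine (div_le_self (by linarith) (by linarith)).trans hu1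
      _ = N := by
          rw [one_div, Real.inv_rpow hρ0.le, hρs, inv_inv]
  · intro x hx
    have hxN : (x : ℝ) + 1 ≤ N := by exact_mod_cast Finset.mem_range.1 hx
    have hx0 : (0 : ℝ) ≤ x := by positivity
    rcases le_total i x with hix | hix
    · apply hpR x hix
      nlinarith
    · apply hpL x hix
      nlinarith

lemma summ (hρ0 : 0 < ρ) (hρ1 : ρ < 1) {d : ℕ → ℕ} (hd : ∀ i, d i < N) :
    Summable fun i => (d i : ℝ) * ρ ^ i := by
  refine Summable.of_nonneg_of_le (fun i => by positivity) (fun i => ?_)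
    ((summable_geometric_of_lt_one hρ0.le hρ1).mul_left (N : ℝ))
  gcongr
  exact (hd i).le

lemma R_nonneg (hN : 2 ≤ N) (hρ1 : ρ < 1) : 0 ≤ R N ρ := by
  have h := N_ge hN
  unfold R
  exact div_nonneg (by linarith) (by linarith)

lemma piMap_mem (hN : 2 ≤ N) (hρ0 : 0 < ρ) (hρ1 : ρ < 1) {d : ℕ → ℕ} (hd : ∀ i, d i < N) :
    0 ≤ piMap N ρ d ∧ piMap N ρ d ≤ 1 := by
  have hR := R_nonneg hN hρ1
  have hRm := R_mul (ρ := ρ) hN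
  unfold piMap
  constructor
  · exact mul_nonneg hR (tsum_nonneg fun i => by positivity)
  · have h1 : ∑' i : ℕ, (d i : ℝ) * ρ ^ i ≤ ∑' i : ℕ, ((N : ℝ) - 1) * ρ ^ i := by
      refine Summable.tsum_le_tsum (fun i => ?_) (summ hρ0 hρ1 hd)
        ((summable_geometric_of_lt_one hρ0.le hρ1).mul_left _)
      have : (d i : ℝ) + 1 ≤ N := by exact_mod_cast hd i
      gcongr
      linarith
    rw [tsum_mul_left, tsum_geometric_of_lt_one hρ0.le hρ1] at h1
    calc R N ρ * ∑' i : ℕ, (d i : ℝ) * ρ ^ i ≤ R N ρ * (((N : ℝ) - 1) * (1 - ρ)⁻¹) := by gcongr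
      _ = 1 := by
        rw [← mul_assoc, hRm, mul_inv_cancel₀]
        linarith

lemma Tn_succ (hρ0 : 0 < ρ) (hρ1 : ρ < 1) {d : ℕ → ℕ} (hd : ∀ i, d i < N) (n : ℕ) :
    Tn N ρ d n = f N ρ (d n) (Tn N ρ d (n + 1)) := by
  unfold Tn piMap f
  rw [(summ hρ0 hρ1 (d := fun i => d (n + i)) (fun i => hd _)).tsum_eq_zero_add]
  have : ∀ i : ℕ, (d (n + (i + 1)) : ℝ) * ρ ^ (i + 1) = ρ * ((d (n + 1 + i) : ℝ) * ρ ^ i) := by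
    intro i
    rw [show n + (i + 1) = n + 1 + i by ring]
    ring
  simp only [this, tsum_mul_left]
  simp
  ring

lemma Tn_zero (d : ℕ → ℕ) : Tn N ρ d 0 = piMap N ρ d := by
  unfold Tn
  simp

/-- the function γ -/
noncomputable def gam (N : ℕ) (ρ : ℝ) (d : ℕ → ℕ) (n : ℕ) : ℝ :=
  if d n = 0 then Tn N ρ d (n + 1)
  else if d n = N - 1 then 1 - Tn N ρ d (n + 1)
  else max (Tn N ρ d (n + 1)) (1 - Tn N ρ d (n + 1))

lemma gam_cases (hN : 2 ≤ N) {d : ℕ → ℕ} (hd : ∀ i, d i < N) (n : ℕ) :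
    (gam N ρ d n = Tn N ρ d (n + 1) ∧ d n + 1 < N) ∨
      (gam N ρ d n = 1 - Tn N ρ d (n + 1) ∧ 1 ≤ d n) := by
  have := hd n
  unfold gam
  split_ifs with h1 h2
  · left; exact ⟨rfl, by omega⟩
  · right; exact ⟨rfl, by omega⟩
  · rcases max_choice (Tn N ρ d (n + 1)) (1 - Tn N ρ d (n + 1)) with h | h
    · left; exact ⟨h, by omega⟩
    · right; exact ⟨h, by omega⟩

lemma gam_ge {d : ℕ → ℕ} (n : ℕ) :
    (d n + 1 < N → Tn N ρ d (n + 1) ≤ gam N ρ d n) ∧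
      (1 ≤ d n → 1 - Tn N ρ d (n + 1) ≤ gam N ρ d n) := by
  unfold gam
  split_ifs with h1 h2
  · exact ⟨fun _ => le_rfl, fun _ => by omega⟩
  · exact ⟨fun _ => by omega, fun _ => le_rfl⟩
  · exact ⟨fun _ => le_max_left _ _, fun _ => le_max_right _ _⟩

lemma ball_iter [IsProbabilityMeasure μ] (hN : 2 ≤ N) (hρ0 : 0 < ρ) (hρ1 : ρ ≤ 1 / (N : ℝ) ^ 2)
    (hss : IsSelfSimilar N ρ μ) (hsupp : μ.real (Icc 0 1) = 1) {d : ℕ → ℕ} (hd : ∀ i, d i < N)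
    {u : ℝ} (hu0 : 0 ≤ u) (hu : u ≤ 1) (n : ℕ) :
    ball μ (piMap N ρ d) (ρ ^ n * u) = ((N : ℝ)⁻¹) ^ n * ball μ (Tn N ρ d n) u := by
  have hr := rho_le hN hρ0 hρ1
  have hK := K_ge hN hρ0 hρ1
  have h := N_ge hN
  have key : ∀ n m, ball μ (Tn N ρ d m) (ρ ^ n * u) =
      ((N : ℝ)⁻¹) ^ n * ball μ (Tn N ρ d (m + n)) u := by
    intro n
    induction n with
    | zero => intro m; simp
    | succ n ih =>
      intro m
      have hT := piMap_mem hN hρ0 (by linarith) (d := fun i => d (m + 1 + i)) (fun i => hd _)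
      change 0 ≤ Tn N ρ d (m + 1) ∧ Tn N ρ d (m + 1) ≤ 1 at hT
      have hle : ρ ^ n * u ≤ 1 :=
        mul_le_one₀ (pow_le_one₀ hρ0.le (by linarith)) hu0 hu
      rw [Tn_succ hρ0 (by linarith) hd m, pow_succ', mul_assoc,
        ball_scale hN hρ0 hρ1 hss hsupp (hd m), ih, pow_succ', mul_assoc,
        show m + 1 + n = m + (n + 1) by ring]
      · intro _; linarith
      · intro _; linarith
  have := key n 0
  rwa [Tn_zero, zero_add] at this

end helpers

/-- Theorem 1 (i): pointwise lower `s`-density of the homogeneous Cantor measure. -/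
theorem lowerDensity_eq (N : ℕ) (hN : 2 ≤ N) (ρ : ℝ) (hρ0 : 0 < ρ)
    (hρ1 : ρ ≤ 1 / (N : ℝ) ^ 2) (s : ℝ) (hs : s = -Real.log N / Real.log ρ)
    (μ : Measure ℝ) (hprob : IsProbabilityMeasure μ) (hss : IsSelfSimilar N ρ μ)
    (d : ℕ → ℕ) (hd : ∀ i, d i < N) :
    lowerDensity μ s (piMap N ρ d) =
      (2 : ℝ) ^ (-s) *
        (R N ρ / ρ -
            liminf (fun n : ℕ =>
              if d n = 0 then Tn N ρ d (n + 1)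
              else if d n = N - 1 then 1 - Tn N ρ d (n + 1)
              else max (Tn N ρ d (n + 1)) (1 - Tn N ρ d (n + 1))) atTop) ^ (-s) := by
  have hr := rho_le hN hρ0 hρ1
  have hK := K_ge hN hρ0 hρ1
  have h := N_ge hN
  obtain ⟨hs0, hs1, hρs⟩ := s_facts hN hρ0 hρ1 hs
  have hsupp := supp hN hρ0 hρ1 hss
  have hRK : R N ρ = ρ * (R N ρ / ρ) := by field_simp
  have hRm := R_mul (ρ := ρ) hN
  have hRnn := R_nonneg (ρ := ρ) hN (by linarith)
  have hR1 : R N ρ ≤ 1 := by nlinarith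
  change liminf (fun r : ℝ => ball μ (piMap N ρ d) r / (2 * r) ^ s) (𝓝[>] 0) =
    (2 : ℝ) ^ (-s) * (R N ρ / ρ - liminf (gam N ρ d) atTop) ^ (-s)
  set K := R N ρ / ρ with hKdef
  set x := piMap N ρ d
  set g := gam N ρ d with hg
  have hT : ∀ n, 0 ≤ Tn N ρ d n ∧ Tn N ρ d n ≤ 1 := fun n =>
    piMap_mem hN hρ0 (by linarith) (d := fun i => d (n + i)) (fun i => hd _)
  have hg01 : ∀ n, 0 ≤ g n ∧ g n ≤ 1 := by
    intro n
    have := hT (n + 1)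
    rcases gam_cases (ρ := ρ) hN hd n with h | h <;> rw [hg, h.1] <;> constructor <;> linarith
  set φ : ℝ → ℝ := fun v => (2 : ℝ) ^ (-s) * (K - v) ^ (-s) with hφ
  have hφmono : ∀ a b, a ≤ b → b < K → φ a ≤ φ b := by
    intro a b hab hb
    simp only [hφ]
    gcongr ?_ * ?_
    exact Real.rpow_le_rpow_of_nonpos (by linarith) (by linarith) (by linarith)
  -- scale
  have hden : ∀ (n : ℕ) (u : ℝ), 0 ≤ u →
      (2 * (ρ ^ n * u)) ^ s = 2 ^ s * (((N : ℝ)⁻¹) ^ n * u ^ s) := by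
    intro n u hu
    rw [Real.mul_rpow (by norm_num) (by positivity), Real.mul_rpow (by positivity) hu, ← hρs,
      ← Real.rpow_natCast, ← Real.rpow_natCast, ← Real.rpow_mul hρ0.le, ← Real.rpow_mul hρ0.le,
      mul_comm (n : ℝ) s]
  have hφeq : ∀ v, v < K → φ v = 1 / (2 ^ s * (K - v) ^ s) := by
    intro v hv
    simp only [hφ]
    rw [Real.rpow_neg (by norm_num), Real.rpow_neg (by linarith), one_div, mul_inv]
  set H : ℝ → ℝ := fun r => ball μ x r / (2 * r) ^ s with hH
  have hNpos : ∀ n : ℕ, 0 < ((N : ℝ)⁻¹) ^ n := fun n => by positivity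
  have hupper : ∀ n : ℕ, H (ρ ^ (n + 1) * (K - g n)) ≤ φ (g n) := by
    intro n
    have hgn := hg01 n
    have hge := gam_ge (N := N) (ρ := ρ) (d := d) n
    have hpos : 0 < K - g n := by linarith
    have e1 : ρ ^ (n + 1) * (K - g n) = ρ ^ n * (ρ * (K - g n)) := by ring
    have hb : ball μ x (ρ ^ (n + 1) * (K - g n)) ≤ ((N : ℝ)⁻¹) ^ (n + 1) := by
      rw [e1, ball_iter hN hρ0 hρ1 hss hsupp hd (by positivity), Tn_succ hρ0 (by linarith) hd n,
        ball_scale hN hρ0 hρ1 hss hsupp (hd n), pow_succ]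
      · have : ball μ (Tn N ρ d (n + 1)) (K - g n) ≤ 1 := measureReal_le_one
        calc _ ≤ ((N : ℝ)⁻¹) ^ n * ((N : ℝ)⁻¹ * 1) := by gcongr
          _ = _ := by ring
      · intro hh
        have := hge.1 hh
        linarith
      · intro hh
        have := hge.2 hh
        linarith
      · nlinarith
    simp only [hH]
    rw [hden _ _ hpos.le, hφeq _ (by linarith), div_le_div_iff₀ (by positivity) (by positivity)]
    have hp : 0 ≤ (2 : ℝ) ^ s * (K - g n) ^ s := by positivity
    nlinarith [mul_le_mul_of_nonneg_right hb hp]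
  have hlower : ∀ (n : ℕ) (u : ℝ), 1 < u → u ≤ 1 / ρ → φ (g n) ≤ H (ρ ^ (n + 1) * u) := by
    intro n u hu hu1
    have hgn := hg01 n
    have hpos : 0 < K - g n := by linarith
    have hloc := lower_local hN hρ0 hρ1 hs hss hsupp (hd n) (hT (n + 1)).1 (hT (n + 1)).2 hu hu1
      (gam_cases hN hd n)
    have hρu : ρ * u ≤ 1 := by
      rw [le_div_iff₀ hρ0] at hu1
      linarith
    have e1 : ρ ^ (n + 1) * u = ρ ^ n * (ρ * u) := by ring
    have hb : ((N : ℝ)⁻¹) ^ (n + 1) * (u / (K - g n)) ^ s ≤ ball μ x (ρ ^ (n + 1) * u) := by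
      rw [e1, ball_iter hN hρ0 hρ1 hss hsupp hd (by positivity) hρu,
        Tn_succ hρ0 (by linarith) hd n, ball_ss hρ0 hss, pow_succ, mul_assoc]
      gcongr
    simp only [hH]
    rw [hden _ _ (by linarith), hφeq _ (by linarith), div_le_div_iff₀ (by positivity)
      (by positivity)]
    rw [Real.div_rpow (by linarith) hpos.le] at hb
    have hp : 0 ≤ (2 : ℝ) ^ s * (K - g n) ^ s := by positivity
    have hq : (K - g n) ^ s ≠ 0 := by positivity
    calc 1 * (2 ^ s * (((N : ℝ)⁻¹) ^ (n + 1) * u ^ s))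
        = ((N : ℝ)⁻¹) ^ (n + 1) * (u ^ s / (K - g n) ^ s) * (2 ^ s * (K - g n) ^ s) := by
          field_simp
      _ ≤ _ := by gcongr
  have hH0 : IsBoundedUnder (· ≥ ·) (𝓝[>] (0 : ℝ)) H := by
    refine ⟨0, ?_⟩
    rw [eventually_map]
    filter_upwards [self_mem_nhdsWithin] with r hr
    have hr : 0 < r := hr
    exact div_nonneg (ball_nonneg _ _) (by positivity)
  have hrn : Tendsto (fun n : ℕ => ρ ^ (n + 1) * (K - g n)) atTop (𝓝[>] 0) := by
    rw [tendsto_nhdsWithin_iff]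
    constructor
    · have h1 : Tendsto (fun n : ℕ => ρ ^ (n + 1) * K) atTop (𝓝 0) := by
        simpa using ((tendsto_pow_atTop_nhds_zero_of_lt_one hρ0.le
          (by linarith)).comp (tendsto_add_atTop_nat 1)).mul_const K
      refine squeeze_zero (fun n => ?_) (fun n => ?_) h1
      · have := hg01 n
        exact mul_nonneg (by positivity) (by linarith)
      · have := hg01 n
        gcongr
        linarith
    · refine Eventually.of_forall fun n => ?_
      have := hg01 n
      have h1 : 0 < K - g n := by linarith
      have h2 : 0 < ρ ^ (n + 1) * (K - g n) := by positivity
      exact h2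
  have hgbd : IsBoundedUnder (· ≥ ·) atTop g := isBoundedUnder_of ⟨0, fun n => (hg01 n).1⟩
  have hgbd' : IsBoundedUnder (· ≤ ·) atTop g := isBoundedUnder_of ⟨1, fun n => (hg01 n).2⟩
  have hL1 : liminf g atTop ≤ 1 :=
    liminf_le_of_frequently_le (Frequently.of_forall fun n => (hg01 n).2) hgbd
  have hfreq : ∀ b, (∃ᶠ n in atTop, g n ≤ b) → b < K → ∃ᶠ r in 𝓝[>] (0 : ℝ), H r ≤ φ b := by
    intro b hb hbK
    refine hrn.frequently (hb.mono fun n hn => ?_)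
    exact (hupper n).trans (hφmono _ _ hn hbK)
  have hHcob : IsCoboundedUnder (· ≥ ·) (𝓝[>] (0 : ℝ)) H :=
    IsCobounded.of_frequently_le
      (hfreq 1 (Frequently.of_forall fun n => (hg01 n).2) (by linarith))
  have hcont : ContinuousAt φ (liminf g atTop) := by
    refine ContinuousAt.mul continuousAt_const ?_
    refine ContinuousAt.rpow_const (by fun_prop) ?_
    left
    linarith
  change liminf H (𝓝[>] 0) = φ (liminf g atTop)
  apply le_antisymm
  · have ht : Tendsto φ (𝓝[>] (liminf g atTop)) (𝓝 (φ (liminf g atTop))) :=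
      hcont.mono_left nhdsWithin_le_nhds
    refine ge_of_tendsto ht ?_
    have hmem : Ioo (liminf g atTop) K ∈ 𝓝[>] (liminf g atTop) :=
      Ioo_mem_nhdsGT (by linarith)
    filter_upwards [hmem] with b hb
    refine liminf_le_of_frequently_le ?_ hH0
    refine hfreq b ?_ hb.2
    exact (frequently_lt_of_liminf_lt hgbd'.isCoboundedUnder_ge hb.1).mono fun n hn => hn.le
  · have ht : Tendsto φ (𝓝[<] (liminf g atTop)) (𝓝 (φ (liminf g atTop))) :=
      hcont.mono_left nhdsWithin_le_nhds
    refine le_of_tendsto ht ?_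
    filter_upwards [self_mem_nhdsWithin] with b hb
    refine le_liminf_of_le hHcob ?_
    have hev := eventually_lt_of_lt_liminf hb hgbd
    obtain ⟨n0, hn0⟩ := eventually_atTop.1 hev
    have hmem : Ioo (0 : ℝ) (ρ ^ (n0 + 1)) ∈ 𝓝[>] (0 : ℝ) := Ioo_mem_nhdsGT (by positivity)
    filter_upwards [hmem] with r hr'
    have hple : ρ ^ (n0 + 1) ≤ 1 := pow_le_one₀ hρ0.le (by linarith)
    obtain ⟨k, hk1, hk2⟩ := exists_scale hρ0 (by linarith) hr'.1 (by linarith [hr'.2])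
    have hk : n0 ≤ k := by
      by_contra hlt
      have : ρ ^ (n0 + 1) ≤ ρ ^ (k + 1) :=
        pow_le_pow_of_le_one hρ0.le (by linarith) (by omega)
      have h2 : ρ ^ n0 ≤ ρ ^ (k + 1) :=
        pow_le_pow_of_le_one hρ0.le (by linarith) (by omega)
      have h3 : ρ ^ (n0 + 1) ≤ ρ ^ n0 :=
        pow_le_pow_of_le_one hρ0.le (by linarith) (by omega)
      linarith [hr'.2]
    have hlow := hlower k (r / ρ ^ (k + 1)) ((one_lt_div (by positivity)).2 hk1) (by
      rw [div_le_div_iff₀ (by positivity) hρ0, pow_succ]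
      nlinarith)
    rw [mul_div_cancel₀ _ (by positivity)] at hlow
    exact (hφmono _ _ (hn0 k hk).le (by linarith [(hg01 k).2])).trans hlow

end HomogeneousCantorDensity
end

section
/- For μ-almost every x ∈ E one has Θ_*^s(μ,x) = (2R/ρ)^{-s}, and Θ^{*s}(μ,x) = 1 if N is odd while Θ^{*s}(μ,x) = (NR)^{-s} if N is even. -/
open MeasureTheory Filter Set Topology ENNReal

namespace HomogeneousCantorDensity

/-- The standing assumptions. -/
structure Setup (N : ℕ) (ρ s : ℝ) (μ : Measure ℝ) : Prop where
  hN : 2 ≤ N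
  hρ0 : 0 < ρ
  hρ1 : ρ ≤ 1 / (N : ℝ) ^ 2
  hs : s = -Real.log N / Real.log ρ
  prob : IsProbabilityMeasure μ
  ss : IsSelfSimilar N ρ μ

namespace Setup

variable {N : ℕ} {ρ s : ℝ} {μ : Measure ℝ}

lemma N2 (H : Setup N ρ s μ) : (2 : ℝ) ≤ N := by exact_mod_cast H.hN

lemma hρN (H : Setup N ρ s μ) : ρ * (N : ℝ) ^ 2 ≤ 1 := by
  have h := H.hρ1
  have := H.N2
  rwa [le_div_iff₀ (by positivity)] at h

lemma ρ4 (H : Setup N ρ s μ) : ρ ≤ 1 / 4 := by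
  have h := H.hρN
  have h2 := H.N2
  have := H.hρ0
  have : (4 : ℝ) ≤ (N : ℝ) ^ 2 := by nlinarith
  nlinarith

lemma R_eq (H : Setup N ρ s μ) : ((N : ℝ) - 1) * R N ρ = 1 - ρ := by
  have := H.N2
  unfold R
  field_simp [show ((N : ℝ) - 1) ≠ 0 by linarith]

lemma R_pos (H : Setup N ρ s μ) : 0 < R N ρ := by
  have := H.N2
  have := H.ρ4
  unfold R
  apply div_pos <;> linarith

lemma R_big (H : Setup N ρ s μ) : ρ * ((N : ℝ) + 1) ≤ R N ρ := by
  have := H.N2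
  have := H.hρN
  unfold R
  rw [le_div_iff₀ (by linarith)]
  nlinarith

lemma R3 (H : Setup N ρ s μ) : 3 * ρ ≤ R N ρ := by
  have := H.N2
  have := H.R_big
  have := H.hρ0
  nlinarith

lemma NR (H : Setup N ρ s μ) : 1 ≤ N * R N ρ := by
  have := H.R_eq
  have := H.R3
  have := H.hρ0
  nlinarith

lemma R_le (H : Setup N ρ s μ) : R N ρ ≤ 1 := by
  have := H.R_eq
  have := H.R_pos
  have := H.hρ0
  have := H.N2
  nlinarith

lemma logρ (H : Setup N ρ s μ) : Real.log ρ < 0 :=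
  Real.log_neg H.hρ0 (by linarith [H.ρ4])

lemma logN (H : Setup N ρ s μ) : 0 < Real.log N :=
  Real.log_pos (by linarith [H.N2])

lemma s_pos (H : Setup N ρ s μ) : 0 < s := by
  rw [H.hs]
  exact div_pos_of_neg_of_neg (by linarith [H.logN]) H.logρ

lemma s_half (H : Setup N ρ s μ) : s ≤ 1 / 2 := by
  have h1 : Real.log (ρ * (N : ℝ) ^ 2) ≤ 0 :=
    Real.log_nonpos (by have := H.hρ0; positivity) H.hρN
  rw [Real.log_mul H.hρ0.ne' (by have := H.N2; positivity), Real.log_pow] at h1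
  rw [H.hs, div_le_iff_of_neg H.logρ]
  push_cast at h1
  linarith

lemma ρs (H : Setup N ρ s μ) : ρ ^ s = 1 / N := by
  have := H.N2
  rw [Real.rpow_def_of_pos H.hρ0, H.hs, mul_div_cancel₀ _ H.logρ.ne, Real.exp_neg,
    Real.exp_log (by positivity), one_div]

lemma f_emb (H : Setup N ρ s μ) (i : ℕ) : MeasurableEmbedding (f N ρ i) := by
  have h1 : f N ρ i = (fun x => x + (i : ℝ) * R N ρ) ∘ (fun x => ρ * x) := rfl
  rw [h1]
  exact (measurableEmbedding_addRight _).comp (measurableEmbedding_mulLeft₀ H.hρ0.ne')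

lemma ss_real (H : Setup N ρ s μ) (S : Set ℝ) :
    μ.real S = (1 / N) * ∑ i ∈ Finset.range N, μ.real (f N ρ i ⁻¹' S) := by
  have := H.prob
  have h := H.ss
  unfold IsSelfSimilar at h
  have h2 : μ S = ∑ i ∈ Finset.range N, (N : ℝ≥0∞)⁻¹ * μ (f N ρ i ⁻¹' S) := by
    conv_lhs => rw [h]
    rw [Measure.finsetSum_apply]
    refine Finset.sum_congr rfl fun i _ => ?_
    rw [Measure.smul_apply, (H.f_emb i).map_apply, smul_eq_mul]
  unfold Measure.real
  rw [h2, ENNReal.toReal_sum, Finset.mul_sum]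
  · refine Finset.sum_congr rfl fun i _ => ?_
    simp
  · intro i _
    refine ENNReal.mul_ne_top ?_ (measure_ne_top _ _)
    simp
    have := H.hN
    omega

lemma f_bd (H : Setup N ρ s μ) {i : ℕ} (hi : i < N) : 0 ≤ (i : ℝ) * R N ρ ∧
    (i : ℝ) * R N ρ ≤ 1 - ρ := by
  have hi' : (i : ℝ) + 1 ≤ N := by exact_mod_cast hi
  have := H.R_pos
  have := H.R_eq
  refine ⟨by positivity, ?_⟩
  nlinarith

lemma supp_step (H : Setup N ρ s μ) (L : ℝ) :
    μ.real (Icc (-L) (1 + L))ᶜ ≤ μ.real (Icc (-(L / ρ)) (1 + L / ρ))ᶜ := by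
  have := H.prob
  have hN := H.N2
  have h0 := H.hρ0
  rw [H.ss_real]
  have : ∑ i ∈ Finset.range N, μ.real (f N ρ i ⁻¹' (Icc (-L) (1 + L))ᶜ)
      ≤ ∑ i ∈ Finset.range N, μ.real (Icc (-(L / ρ)) (1 + L / ρ))ᶜ := by
    refine Finset.sum_le_sum fun i hi => ?_
    apply measureReal_mono _ (measure_ne_top _ _)
    obtain ⟨h1, h2⟩ := H.f_bd (Finset.mem_range.1 hi)
    intro x hx hx2
    apply hx
    have e : ρ * (L / ρ) = L := by field_simp
    have a1 := mul_le_mul_of_nonneg_left hx2.1 h0.le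
    have a2 := mul_le_mul_of_nonneg_left hx2.2 h0.le
    constructor <;> unfold f <;> nlinarith
  rw [Finset.sum_const, Finset.card_range, nsmul_eq_mul] at this
  rw [one_div, inv_mul_le_iff₀ (by positivity)]
  exact this

lemma supp_pos (H : Setup N ρ s μ) (L : ℝ) (hL : 0 < L) :
    μ (Icc (-L) (1 + L))ᶜ = 0 := by
  have := H.prob
  have h0 := H.hρ0
  have h4 := H.ρ4
  have h1 : ∀ n : ℕ, μ.real (Icc (-L) (1 + L))ᶜ
      ≤ μ.real (Icc (-(L / ρ ^ n)) (1 + L / ρ ^ n))ᶜ := by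
    intro n
    induction n with
    | zero => simp
    | succ n ih =>
      refine ih.trans ((H.supp_step _).trans (le_of_eq ?_))
      rw [div_div, ← pow_succ]
  have hlim : Tendsto (fun n : ℕ => L / ρ ^ n) atTop atTop := by
    have := (tendsto_pow_atTop_atTop_of_one_lt
      (show (1 : ℝ) < ρ⁻¹ by rw [one_lt_inv₀ h0]; linarith)).const_mul_atTop hL
    refine this.congr fun n => ?_
    rw [inv_pow, div_eq_mul_inv]
  have hmono : Antitone (fun n : ℕ => (Icc (-(L / ρ ^ n)) (1 + L / ρ ^ n))ᶜ) := by
    intro a b hab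
    apply compl_subset_compl.2
    have : L / ρ ^ a ≤ L / ρ ^ b := by
      apply div_le_div_of_nonneg_left hL.le (by positivity)
      exact pow_le_pow_of_le_one h0.le (by linarith) hab
    apply Icc_subset_Icc <;> linarith
  have hemp : ⋂ n : ℕ, (Icc (-(L / ρ ^ n)) (1 + L / ρ ^ n))ᶜ = ∅ := by
    rw [← compl_iUnion, compl_empty_iff, eq_univ_iff_forall]
    intro x
    obtain ⟨n, hn⟩ := (hlim.eventually_ge_atTop |x|).exists
    rw [mem_iUnion]
    refine ⟨n, ?_, ?_⟩
    · linarith [neg_abs_le x]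
    · linarith [le_abs_self x]
  have ht := tendsto_measure_iInter_atTop (μ := μ)
    (fun n => (measurableSet_Icc (a := -(L / ρ ^ n)) (b := 1 + L / ρ ^ n)).compl.nullMeasurableSet)
    hmono ⟨0, measure_ne_top _ _⟩
  rw [hemp, measure_empty] at ht
  have h2 : ∀ n : ℕ, μ (Icc (-L) (1 + L))ᶜ
      ≤ μ (Icc (-(L / ρ ^ n)) (1 + L / ρ ^ n))ᶜ := fun n =>
    (ENNReal.toReal_le_toReal (measure_ne_top _ _) (measure_ne_top _ _)).1 (h1 n)
  exact le_antisymm (ge_of_tendsto' ht h2) (zero_le)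

lemma supp (H : Setup N ρ s μ) : μ (Icc 0 1)ᶜ = 0 := by
  have : (Icc (0 : ℝ) 1)ᶜ = ⋃ n : ℕ, (Icc (-(1 / ((n : ℝ) + 1))) (1 + 1 / ((n : ℝ) + 1)))ᶜ := by
    rw [← compl_iInter, compl_inj_iff]
    ext x
    simp only [mem_iInter, mem_Icc]
    constructor
    · rintro ⟨h1, h2⟩ n
      have : 0 < 1 / ((n : ℝ) + 1) := by positivity
      constructor <;> linarith
    · intro h
      have hl := tendsto_one_div_add_atTop_nhds_zero_nat (𝕜 := ℝ)
      constructor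
      · have := le_of_tendsto' (hl.neg) (fun n => (h n).1)
        simpa using this
      · have := ge_of_tendsto' (hl.const_add 1) (fun n => (h n).2)
        simpa using this
  rw [this, measure_iUnion_null_iff]
  intro n
  exact H.supp_pos _ (by positivity)

lemma real_of_disj (H : Setup N ρ s μ) {S : Set ℝ} (h : ∀ x ∈ S, 0 ≤ x → x ≤ 1 → False) :
    μ.real S = 0 := by
  have hsub : S ⊆ (Icc 0 1)ᶜ := fun x hx hx2 => h x hx hx2.1 hx2.2
  have : μ S = 0 := measure_mono_null hsub H.supp
  simp [Measure.real, this]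

lemma real_of_full (H : Setup N ρ s μ) {S : Set ℝ} (h : Icc 0 1 ⊆ S) : μ.real S = 1 := by
  have := H.prob
  have h1 : μ Sᶜ = 0 := measure_mono_null (compl_subset_compl.2 h) H.supp
  have : μ S = 1 := (prob_compl_eq_zero_iff₀ (NullMeasurableSet.of_compl
    (NullMeasurableSet.of_null h1))).1 h1
  simp [Measure.real, this]

end Setup

/-- mass of an open interval -/
noncomputable def F (μ : Measure ℝ) (a b : ℝ) : ℝ := μ.real (Ioo a b)

namespace Setup
variable {N : ℕ} {ρ s : ℝ} {μ : Measure ℝ}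

lemma F_nonneg (a b : ℝ) : 0 ≤ F μ a b := measureReal_nonneg

lemma F_le_one (H : Setup N ρ s μ) (a b : ℝ) : F μ a b ≤ 1 := by
  have := H.prob
  exact measureReal_le_one

lemma F_mono (H : Setup N ρ s μ) {a b c d : ℝ} (h1 : c ≤ a) (h2 : b ≤ d) : F μ a b ≤ F μ c d := by
  have := H.prob
  exact measureReal_mono (Ioo_subset_Ioo h1 h2) (measure_ne_top _ _)

lemma F_right (H : Setup N ρ s μ) {a b : ℝ} (h : 1 ≤ a) : F μ a b = 0 :=
  H.real_of_disj fun x hx _ h1 => by linarith [hx.1]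

lemma F_left (H : Setup N ρ s μ) {a b : ℝ} (h : b ≤ 0) : F μ a b = 0 :=
  H.real_of_disj fun x hx h1 _ => by linarith [hx.2]

lemma F_full (H : Setup N ρ s μ) {a b : ℝ} (h : a < 0) (h' : 1 < b) : F μ a b = 1 :=
  H.real_of_full fun x hx => ⟨by linarith [hx.1], by linarith [hx.2]⟩

lemma F_ss (H : Setup N ρ s μ) (i : ℕ) (t r : ℝ) :
    F μ (f N ρ i t - r) (f N ρ i t + r) = (1 / N) * ∑ j ∈ Finset.range N,
      F μ (t + (((i : ℝ) - j) * R N ρ - r) / ρ) (t + (((i : ℝ) - j) * R N ρ + r) / ρ) := by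
  unfold F
  rw [H.ss_real]
  congr 1
  refine Finset.sum_congr rfl fun j _ => ?_
  congr 1
  have h0 := H.hρ0
  ext x
  simp only [mem_preimage, mem_Ioo, f]
  have e1 : t + (((i : ℝ) - j) * R N ρ - r) / ρ < x ↔ ρ * t + (((i : ℝ) - j) * R N ρ - r) < ρ * x := by
    rw [← mul_lt_mul_iff_right₀ h0]
    field_simp
  have e2 : x < t + (((i : ℝ) - j) * R N ρ + r) / ρ ↔ ρ * x < ρ * t + (((i : ℝ) - j) * R N ρ + r) := by
    rw [← mul_lt_mul_iff_right₀ h0]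
    field_simp
  rw [e1, e2]
  constructor <;> rintro ⟨h1, h2⟩ <;> constructor <;> linarith

lemma F_add (H : Setup N ρ s μ) (t d a b : ℝ) :
    F μ (t - d) a + F μ b (t + d) ≤ 1 + F μ (t - d) (t + d) := by
  have := H.prob
  have h1 : F μ (t - d) a ≤ μ.real (Ioi (t - d)) :=
    measureReal_mono (fun x hx => hx.1) (measure_ne_top _ _)
  have h2 : F μ b (t + d) ≤ μ.real (Iio (t + d)) :=
    measureReal_mono (fun x hx => hx.2) (measure_ne_top _ _)
  have h3 := measureReal_union_add_inter (μ := μ) (s := Ioi (t - d)) (t := Iio (t + d))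
    measurableSet_Iio
  have h4 : μ.real (Ioi (t - d) ∪ Iio (t + d)) ≤ 1 := measureReal_le_one
  have h5 : Ioi (t - d) ∩ Iio (t + d) = Ioo (t - d) (t + d) := rfl
  rw [h5] at h3
  unfold F at *
  linarith

lemma F_disj (H : Setup N ρ s μ) {b c : ℝ} (hd : b ≤ c) (a d : ℝ) :
    F μ a b + F μ c d ≤ 1 := by
  have := H.prob
  have h3 := measureReal_union (μ := μ) (s₁ := Ioo a b) (s₂ := Ioo c d)
    (by rw [Set.disjoint_left]; intro x h1 h2; linarith [h1.2, h2.1]) measurableSet_Ioo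
  have h4 : μ.real (Ioo a b ∪ Ioo c d) ≤ 1 := measureReal_le_one
  unfold F at *
  linarith

lemma E_sub (H : Setup N ρ s μ) {x : ℝ} (hx : x ∈ cantorE N ρ) : 0 ≤ x ∧ x ≤ 1 := by
  obtain ⟨d, hd, rfl⟩ := hx
  have h0 := H.hρ0
  have h4 := H.ρ4
  have hR := H.R_pos
  have hg := summable_geometric_of_lt_one h0.le (by linarith : ρ < 1)
  have hle : ∀ i, (d i : ℝ) * ρ ^ i ≤ ((N : ℝ) - 1) * ρ ^ i := by
    intro i
    have : (d i : ℝ) + 1 ≤ N := by exact_mod_cast hd i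
    apply mul_le_mul_of_nonneg_right (by linarith) (by positivity)
  have hs2 : Summable fun i => (d i : ℝ) * ρ ^ i :=
    Summable.of_nonneg_of_le (fun i => by positivity) hle (hg.mul_left _)
  unfold piMap
  constructor
  · exact mul_nonneg hR.le (tsum_nonneg fun i => by positivity)
  · have h1 := hs2.tsum_le_tsum hle (hg.mul_left _)
    rw [tsum_mul_left, tsum_geometric_of_lt_one h0.le (by linarith)] at h1
    calc R N ρ * ∑' i, (d i : ℝ) * ρ ^ i ≤ R N ρ * (((N : ℝ) - 1) * (1 - ρ)⁻¹) := by gcongr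
      _ = 1 := by
        rw [← mul_assoc, mul_comm (R N ρ), H.R_eq, mul_inv_cancel₀ (by linarith)]

lemma E_step (H : Setup N ρ s μ) {x : ℝ} (hx : x ∈ cantorE N ρ) :
    ∃ i : Fin N, ∃ t ∈ cantorE N ρ, x = f N ρ i t := by
  obtain ⟨d, hd, rfl⟩ := hx
  have h0 := H.hρ0
  have h4 := H.ρ4
  have hg := summable_geometric_of_lt_one h0.le (by linarith : ρ < 1)
  have hle : ∀ i, (d i : ℝ) * ρ ^ i ≤ ((N : ℝ) - 1) * ρ ^ i := by
    intro i
    have : (d i : ℝ) + 1 ≤ N := by exact_mod_cast hd i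
    apply mul_le_mul_of_nonneg_right (by linarith) (by positivity)
  have hs2 : Summable fun i => (d i : ℝ) * ρ ^ i :=
    Summable.of_nonneg_of_le (fun i => by positivity) hle (hg.mul_left _)
  refine ⟨⟨d 0, hd 0⟩, piMap N ρ (fun i => d (i + 1)), ⟨_, fun i => hd _, rfl⟩, ?_⟩
  unfold piMap f
  rw [hs2.tsum_eq_zero_add]
  have : ∀ i, (d (i + 1) : ℝ) * ρ ^ (i + 1) = ρ * ((d (i + 1) : ℝ) * ρ ^ i) := by
    intro i; ring
  simp_rw [this]
  rw [tsum_mul_left]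
  simp
  ring

end Setup

namespace Setup
variable {N : ℕ} {ρ s : ℝ} {μ : Measure ℝ}

lemma F_ss_ge (H : Setup N ρ s μ) {i : ℕ} (hi : i < N) (t r : ℝ) :
    (1 / N) * F μ (t - r / ρ) (t + r / ρ) ≤ F μ (f N ρ i t - r) (f N ρ i t + r) := by
  rw [H.F_ss]
  apply mul_le_mul_of_nonneg_left _ (by positivity)
  have := Finset.single_le_sum (f := fun j : ℕ => F μ (t + (((i : ℝ) - j) * R N ρ - r) / ρ)
    (t + (((i : ℝ) - j) * R N ρ + r) / ρ)) (fun j _ => F_nonneg _ _) (Finset.mem_range.2 hi)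
  refine le_trans (le_of_eq ?_) this
  congr 1 <;> ring

lemma fix_low (H : Setup N ρ s μ) {i : ℕ} (hi : i < N) {y : ℝ} (hy0 : 0 ≤ y) (hy1 : y ≤ 1)
    (hf : f N ρ i y = y) (m : ℕ) : ∀ u, ρ ^ m < u → u ≤ 1 → u / N ≤ F μ (y - u) (y + u) := by
  have hN := H.N2
  have h0 := H.hρ0
  have h3 := H.hρN
  induction m with
  | zero => intro u h1 h2; simp at h1; linarith
  | succ m ih =>
    intro u h1 h2
    have hu : 0 < u := lt_trans (by positivity) h1
    have key := H.F_ss_ge hi y u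
    rw [hf] at key
    refine le_trans ?_ key
    rw [div_eq_mul_inv, mul_comm, one_div]
    apply mul_le_mul_of_nonneg_left _ (by positivity)
    by_cases hc : ρ < u
    · have : 1 < u / ρ := by rwa [one_lt_div h0]
      rw [H.F_full (by linarith) (by linarith)]
      exact h2
    · push Not at hc
      have := ih (u / ρ) (by rw [lt_div_iff₀ h0]; rwa [pow_succ] at h1) (by rwa [div_le_one h0])
      refine le_trans ?_ this
      rw [div_div, le_div_iff₀ (by positivity)]
      have : ρ * N ≤ 1 := by nlinarith
      nlinarith

lemma fix_low' (H : Setup N ρ s μ) {i : ℕ} (hi : i < N) {y : ℝ} (hy0 : 0 ≤ y) (hy1 : y ≤ 1)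
    (hf : f N ρ i y = y) {u : ℝ} (hu : 0 < u) (hu1 : u ≤ 1) : u / N ≤ F μ (y - u) (y + u) := by
  obtain ⟨m, hm⟩ := exists_pow_lt_of_lt_one hu (by linarith [H.ρ4] : ρ < 1)
  exact H.fix_low hi hy0 hy1 hf m u hm hu1

lemma left_low (H : Setup N ρ s μ) {u a : ℝ} (hu : 0 < u) (hu1 : u ≤ 1) (ha : a ≤ -1) :
    u / N ≤ F μ a u := by
  have h := H.fix_low' (i := 0) (by have := H.hN; omega) le_rfl zero_le_one (by simp [f]) hu hu1
  exact h.trans (H.F_mono (by linarith) (by linarith))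

lemma right_low (H : Setup N ρ s μ) {u a : ℝ} (hu : 0 < u) (hu1 : u ≤ 1) (ha : 2 ≤ a) :
    u / N ≤ F μ (1 - u) a := by
  have hN := H.hN
  have h := H.fix_low' (i := N - 1) (by omega) zero_le_one le_rfl
    (by have := H.R_eq; unfold f; rw [Nat.cast_sub (by omega)]; push_cast; linarith) hu hu1
  exact h.trans (H.F_mono (by linarith) (by linarith))

lemma rpow_le_sqrt (H : Setup N ρ s μ) {x : ℝ} (hx : 1 ≤ x) : x ^ s ≤ √x := by
  rw [Real.sqrt_eq_rpow]
  exact Real.rpow_le_rpow_of_exponent_le hx H.s_half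

lemma sqrt_le_rpow (H : Setup N ρ s μ) {x : ℝ} (hx0 : 0 < x) (hx : x ≤ 1) : √x ≤ x ^ s := by
  rw [Real.sqrt_eq_rpow]
  exact Real.rpow_le_rpow_of_exponent_ge hx0 hx H.s_half

/-- the summand in `F_ss` is full -/
lemma term_full (H : Setup N ρ s μ) {t q r : ℝ} (ht0 : 0 ≤ t) (ht1 : t ≤ 1)
    (h1 : q + ρ < r) (h2 : -q + ρ < r) : F μ (t + (q - r) / ρ) (t + (q + r) / ρ) = 1 := by
  have h0 := H.hρ0
  apply H.F_full
  · have : (q - r) / ρ < -1 := by rw [div_lt_iff₀ h0]; linarith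
    linarith
  · have : 1 < (q + r) / ρ := by rw [lt_div_iff₀ h0]; linarith
    linarith

lemma sum_ge (g : ℕ → ℝ) (hg : ∀ j, 0 ≤ g j) (J : Finset ℕ) (hJ : J ⊆ Finset.range N)
    (h1 : ∀ j ∈ J, g j = 1) : (J.card : ℝ) ≤ ∑ j ∈ Finset.range N, g j := by
  have := Finset.sum_le_sum_of_subset_of_nonneg hJ (f := g) (fun j _ _ => hg j)
  rw [Finset.sum_congr rfl h1] at this
  simpa using this

lemma low_top_one (H : Setup N ρ s μ) {i : ℕ} (hi : i < N) {t r : ℝ} (ht0 : 0 ≤ t) (ht1 : t ≤ 1)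
    (hr : R N ρ < r) (hr2 : r ≤ 2 * R N ρ) : (r / R N ρ) ^ s ≤ ∑ j ∈ Finset.range N,
      F μ (t + (((i : ℝ) - j) * R N ρ - r) / ρ) (t + (((i : ℝ) - j) * R N ρ + r) / ρ) := by
  have hN := H.N2
  have hR := H.R_pos
  have h0 := H.hρ0
  have h3 := H.R3
  have hb := H.R_big
  set g : ℕ → ℝ := fun j => F μ (t + (((i : ℝ) - j) * R N ρ - r) / ρ)
    (t + (((i : ℝ) - j) * R N ρ + r) / ρ) with hg
  have hg0 : ∀ j, 0 ≤ g j := fun j => F_nonneg _ _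
  have hgi : g i = 1 := by
    apply H.term_full ht0 ht1 <;> simp <;> linarith
  set u := (r - R N ρ) / ρ with hu
  have hu0 : 0 < u := div_pos (by linarith) h0
  have hru : r = R N ρ + ρ * u := by rw [hu]; field_simp; ring
  -- a neighbour
  obtain ⟨j, hj, hji, hgj⟩ : ∃ j < N, j ≠ i ∧ ((u ≤ 1 → u / N ≤ g j) ∧ (1 < u → 1 ≤ g j)) := by
    by_cases hc : i + 1 < N
    · refine ⟨i + 1, hc, by omega, ?_⟩
      have e1 : t + (((i : ℝ) - (i + 1 : ℕ)) * R N ρ - r) / ρ ≤ -1 := by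
        have : (((i : ℝ) - (i + 1 : ℕ)) * R N ρ - r) / ρ ≤ -2 := by
          rw [div_le_iff₀ h0]; push_cast; nlinarith
        linarith
      have e2 : u ≤ t + (((i : ℝ) - (i + 1 : ℕ)) * R N ρ + r) / ρ := by
        have : u = (((i : ℝ) - (i + 1 : ℕ)) * R N ρ + r) / ρ := by
          rw [hu]; push_cast; congr 1; ring
        linarith
      constructor
      · intro h1
        exact (H.left_low hu0 h1 e1).trans (H.F_mono le_rfl e2)
      · intro h1
        exact (H.F_full (by linarith) (by linarith)).ge
    · have hi1 : 1 ≤ i := by have := H.hN; omega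
      refine ⟨i - 1, by omega, by omega, ?_⟩
      have e1 : 2 ≤ t + (((i : ℝ) - (i - 1 : ℕ)) * R N ρ + r) / ρ := by
        have : 2 ≤ (((i : ℝ) - (i - 1 : ℕ)) * R N ρ + r) / ρ := by
          rw [le_div_iff₀ h0, Nat.cast_sub hi1]; push_cast; nlinarith
        linarith
      have e2 : t + (((i : ℝ) - (i - 1 : ℕ)) * R N ρ - r) / ρ ≤ 1 - u := by
        have : -u = (((i : ℝ) - (i - 1 : ℕ)) * R N ρ - r) / ρ := by
          rw [hu, Nat.cast_sub hi1, ← neg_div]; push_cast; congr 1; ring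
        linarith
      constructor
      · intro h1
        exact (H.right_low hu0 h1 e1).trans (H.F_mono e2 le_rfl)
      · intro h1
        exact (H.F_full (by linarith) (by linarith)).ge
  have hsum : g i + g j ≤ ∑ j ∈ Finset.range N, g j := by
    have := Finset.sum_le_sum_of_subset_of_nonneg (s := {i, j}) (t := Finset.range N) (f := g)
      (by intro a ha; simp at ha; rcases ha with rfl | rfl <;> simpa) (fun j _ _ => hg0 j)
    rwa [Finset.sum_pair (Ne.symm hji)] at this
  refine le_trans ?_ hsum
  rw [hgi]
  have hx1 : 1 ≤ r / R N ρ := by rw [one_le_div hR]; linarith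
  refine (H.rpow_le_sqrt hx1).trans ?_
  rcases le_or_gt u 1 with h1 | h1
  · have := hgj.1 h1
    refine le_trans ?_ (add_le_add_right this 1)
    apply Real.sqrt_le_iff.2 ⟨by positivity, ?_⟩
    have : r / R N ρ ≤ 1 + u / N := by
      rw [div_le_iff₀ hR, hru]
      have : ρ ≤ R N ρ / N := by rw [le_div_iff₀ (by positivity)]; nlinarith
      have : ρ * u ≤ R N ρ / N * u := by gcongr
      calc _ ≤ R N ρ + R N ρ / N * u := by linarith
        _ = _ := by ring
    have : 0 ≤ u / N := by positivity
    nlinarith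
  · have := hgj.2 h1
    have h2 : √(r / R N ρ) ≤ 2 := by
      apply Real.sqrt_le_iff.2 ⟨by positivity, ?_⟩
      rw [div_le_iff₀ hR]; linarith
    linarith

lemma low_top (H : Setup N ρ s μ) {y r : ℝ} (hy : y ∈ cantorE N ρ) (hr : ρ < r) (hr1 : r ≤ 1) :
    (1 / N) * (r / R N ρ) ^ s ≤ F μ (y - r) (y + r) := by
  obtain ⟨i, t, ht, rfl⟩ := H.E_step hy
  obtain ⟨ht0, ht1⟩ := H.E_sub ht
  have hN := H.N2
  have hR := H.R_pos
  have h0 := H.hρ0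
  have h3 := H.R3
  have hE := H.R_eq
  have hi := i.2
  rw [H.F_ss]
  apply mul_le_mul_of_nonneg_left _ (by positivity)
  set g : ℕ → ℝ := fun j => F μ (t + (((i : ℝ) - j) * R N ρ - r) / ρ)
    (t + (((i : ℝ) - j) * R N ρ + r) / ρ) with hg
  have hg0 : ∀ j, 0 ≤ g j := fun j => F_nonneg _ _
  have hr0 : 0 < r := by linarith
  have hk0 : 0 ≤ r / R N ρ := by positivity
  rcases le_or_gt r (R N ρ) with hc | hc
  · have h1 : (r / R N ρ) ^ s ≤ 1 :=
      Real.rpow_le_one (by positivity) (by rwa [div_le_one hR]) H.s_pos.le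
    refine h1.trans ?_
    have := sum_ge (N := N) g hg0 {(i : ℕ)} (by simp) (by
      intro j hj
      simp at hj
      subst hj
      apply H.term_full ht0 ht1 <;> simp <;> linarith)
    simpa using this
  rcases le_or_gt r (2 * R N ρ) with hc2 | hc2
  · exact H.low_top_one hi ht0 ht1 hc hc2
  · -- general k ≥ 2
    obtain ⟨k, hk⟩ : ∃ k : ℕ, k = ⌈r / R N ρ⌉₊ - 1 := ⟨_, rfl⟩
    have hce : 2 < ⌈r / R N ρ⌉₊ := by
      rw [Nat.lt_ceil]
      rw [lt_div_iff₀ hR]; exact_mod_cast hc2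
    have hk2 : 2 ≤ k := by omega
    have hup : r / R N ρ ≤ k + 1 := by
      have := Nat.le_ceil (r / R N ρ)
      have h' : (⌈r / R N ρ⌉₊ : ℝ) = k + 1 := by
        rw [hk]; push_cast [Nat.cast_sub (show 1 ≤ ⌈r / R N ρ⌉₊ by omega)]; ring
      linarith
    have hlo : k * R N ρ < r := by
      have : k < ⌈r / R N ρ⌉₊ := by omega
      rw [Nat.lt_ceil, lt_div_iff₀ hR] at this
      exact this
    have hkN : k < N := by
      have : (k : ℝ) * R N ρ < N * R N ρ := by
        nlinarith
      have := lt_of_mul_lt_mul_right this hR.le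
      exact_mod_cast this
    have h1 : (r / R N ρ) ^ s ≤ k := by
      refine (H.rpow_le_sqrt (by rw [one_le_div hR]; linarith)).trans ?_
      have hk2' : (2 : ℝ) ≤ k := by exact_mod_cast hk2
      apply Real.sqrt_le_iff.2 ⟨by positivity, by nlinarith⟩
    refine h1.trans ?_
    have hfull : ∀ j : ℕ, j + 1 ≤ i + k → i + 1 ≤ j + k → g j = 1 := by
      intro j h1 h2
      have h1' : (j : ℝ) + 1 ≤ i + k := by exact_mod_cast h1
      have h2' : (i : ℝ) + 1 ≤ j + k := by exact_mod_cast h2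
      apply H.term_full ht0 ht1 <;> nlinarith
    by_cases hik : i + k ≤ N
    · have := sum_ge (N := N) g hg0 (Finset.Ico i (i + k))
        (by intro j hj; simp at hj ⊢; omega)
        (by intro j hj; simp at hj; apply hfull <;> omega)
      simpa using this
    · have := sum_ge (N := N) g hg0 (Finset.Ico (N - k) N)
        (by intro j hj; simp at hj ⊢; omega)
        (by intro j hj; simp at hj; apply hfull <;> omega)
      rw [Nat.card_Ico, Nat.sub_sub_self hkN.le] at this
      exact this

lemma low_all (H : Setup N ρ s μ) (m : ℕ) : ∀ y ∈ cantorE N ρ, ∀ r, ρ ^ m < r → r ≤ 1 →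
    (1 / N) * (r / R N ρ) ^ s ≤ F μ (y - r) (y + r) := by
  have h0 := H.hρ0
  have hR := H.R_pos
  induction m with
  | zero => intro y hy r h1 h2; simp at h1; linarith
  | succ m ih =>
    intro y hy r h1 h2
    have hr : 0 < r := lt_trans (by positivity) h1
    by_cases hc : ρ < r
    · exact H.low_top hy hc h2
    · push Not at hc
      obtain ⟨i, t, ht, rfl⟩ := H.E_step hy
      refine le_trans ?_ (H.F_ss_ge i.2 t r)
      apply mul_le_mul_of_nonneg_left _ (by positivity)
      refine le_trans (le_of_eq ?_) (ih t ht (r / ρ)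
        (by rw [lt_div_iff₀ h0]; rwa [pow_succ] at h1) (by rwa [div_le_one h0]))
      rw [← H.ρs, ← Real.mul_rpow h0.le (by positivity)]
      congr 1
      field_simp

lemma low_bound (H : Setup N ρ s μ) {y r : ℝ} (hy : y ∈ cantorE N ρ) (hr : 0 < r) (hr1 : r ≤ 1) :
    (1 / N) * (r / R N ρ) ^ s ≤ F μ (y - r) (y + r) := by
  obtain ⟨m, hm⟩ := exists_pow_lt_of_lt_one hr (by linarith [H.ρ4] : ρ < 1)
  exact H.low_all m y hy r hm hr1

end Setup

namespace Setup
variable {N : ℕ} {ρ s : ℝ} {μ : Measure ℝ}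

lemma term_zero (H : Setup N ρ s μ) {t q r : ℝ} (ht0 : 0 ≤ t) (ht1 : t ≤ 1)
    (h : r + ρ ≤ q ∨ r + ρ ≤ -q) : F μ (t + (q - r) / ρ) (t + (q + r) / ρ) = 0 := by
  have h0 := H.hρ0
  rcases h with h | h
  · apply H.F_right
    have : 1 ≤ (q - r) / ρ := by rw [le_div_iff₀ h0]; linarith
    linarith
  · apply H.F_left
    have : (q + r) / ρ ≤ -1 := by rw [div_le_iff₀ h0]; linarith
    linarith

lemma sum_bound (g : ℕ → ℝ) (hg : ∀ j, 0 ≤ g j) (hg1 : ∀ j, g j ≤ 1) (i k : ℕ)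
    (hz : ∀ j, i + k < j ∨ j + k < i → g j = 0) :
    ∑ j ∈ Finset.range N, g j ≤ ((Finset.range N ∩ Finset.Ico (i + 1 - k) (i + k)).card : ℝ)
      + (if k ≤ i then g (i - k) else 0) + (if i + k < N then g (i + k) else 0) := by
  have hpt : ∀ j ∈ Finset.range N, g j ≤ (if j ∈ Finset.Ico (i + 1 - k) (i + k) then (1 : ℝ) else 0)
      + (if j = i - k then (if k ≤ i then g (i - k) else 0) else 0)
      + (if j = i + k then g (i + k) else 0) := by
    intro j _
    have a1 : 0 ≤ (if j ∈ Finset.Ico (i + 1 - k) (i + k) then (1 : ℝ) else 0) := by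
      split_ifs <;> norm_num
    have a2 : 0 ≤ (if j = i - k then (if k ≤ i then g (i - k) else 0) else 0) := by
      split_ifs <;> first | exact hg _ | exact le_rfl
    have a3 : 0 ≤ (if j = i + k then g (i + k) else 0) := by
      split_ifs <;> first | exact hg _ | exact le_rfl
    by_cases h1 : j ∈ Finset.Ico (i + 1 - k) (i + k)
    · rw [if_pos h1] at a1 ⊢
      linarith [hg1 j]
    by_cases h2 : j = i + k
    · rw [if_pos h2] at a3 ⊢
      rw [h2] at a1 a2 ⊢
      linarith
    by_cases h3 : k ≤ i ∧ j = i - k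
    · rw [if_pos h3.2, if_pos h3.1] at a2 ⊢
      rw [← h3.2] at a2 ⊢
      linarith
    · rw [hz j (by simp at h1; omega)]
      linarith
  refine (Finset.sum_le_sum hpt).trans ?_
  rw [Finset.sum_add_distrib, Finset.sum_add_distrib, Finset.sum_ite_eq', Finset.sum_ite_eq',
    Finset.sum_ite_mem]
  simp only [Finset.sum_const, nsmul_eq_mul, mul_one, Finset.mem_range]
  have : (if i - k < N then (if k ≤ i then g (i - k) else 0) else 0)
      ≤ (if k ≤ i then g (i - k) else 0) := by
    split_ifs <;> first | exact le_rfl | exact hg _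
  linarith

lemma card_bound (i k : ℕ) (hk : 1 ≤ k) :
    (((Finset.range N ∩ Finset.Ico (i + 1 - k) (i + k)).card : ℕ) : ℝ) ≤ 2 * k - 1 := by
  have h : (Finset.range N ∩ Finset.Ico (i + 1 - k) (i + k)).card ≤ 2 * k - 1 := by
    refine (Finset.card_le_card Finset.inter_subset_right).trans ?_
    rw [Nat.card_Ico]; omega
  have h2 : (Finset.range N ∩ Finset.Ico (i + 1 - k) (i + k)).card + 1 ≤ 2 * k := by omega
  have : (((Finset.range N ∩ Finset.Ico (i + 1 - k) (i + k)).card : ℕ) : ℝ) + 1 ≤ 2 * k := by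
    exact_mod_cast h2
  linarith

lemma card_bound2 (i k : ℕ) (hi : i < N) (hk : N = 2 * k) :
    (((Finset.range N ∩ Finset.Ico (i + 1 - k) (i + k)).card : ℕ) : ℝ) ≤ N - 1 := by
  have h2 : (Finset.range N ∩ Finset.Ico (i + 1 - k) (i + k)).card + 1 ≤ N := by
    have : (Finset.range N ∩ Finset.Ico (i + 1 - k) (i + k)).card ≤ 2 * k - 1 := by
      refine (Finset.card_le_card Finset.inter_subset_right).trans ?_
      rw [Nat.card_Ico]; omega
    omega
  have : (((Finset.range N ∩ Finset.Ico (i + 1 - k) (i + k)).card : ℕ) : ℝ) + 1 ≤ N := by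
    exact_mod_cast h2
  linarith

set_option maxHeartbeats 2000000 in
lemma up_step (H : Setup N ρ s μ) {c : ℝ} (hc0 : 0 < c) (hcR : c ≤ N * R N ρ)
    (Hc : ∀ k : ℕ, 1 ≤ k → 2 * k + 1 ≤ N → ∀ b : ℝ, 0 ≤ b → b ≤ 1 / N →
      (2 * k / N + b) ^ (1 / s) ≤ 2 * k * R N ρ / c + b ^ (1 / s))
    {e : ℝ} (he : 0 ≤ e)
    (ih : ∀ t ∈ cantorE N ρ, ∀ r, 0 < r → F μ (t - r) (t + r) ≤ (2 * r / c) ^ s + e)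
    {y r : ℝ} (hy : y ∈ cantorE N ρ) (hr : 0 < r) :
    F μ (y - r) (y + r) ≤ (2 * r / c) ^ s + e / N := by
  have hN := H.N2
  have hR := H.R_pos
  have h0 := H.hρ0
  have h3 := H.R3
  have hb := H.R_big
  have hs0 := H.s_pos
  have hs1 := H.s_half
  have hN0 : (0 : ℝ) < N := by linarith
  have heN : 0 ≤ e / N := by positivity
  have hX0 : 0 < 2 * r / c := by positivity
  rcases le_or_gt 1 (2 * r / c) with hX | hX
  · have := H.F_le_one (y - r) (y + r)
    have := Real.one_le_rpow hX hs0.le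
    linarith
  have h2r : 2 * r < c := by rwa [div_lt_one hc0] at hX
  have hXN : 2 * r / (N * R N ρ) ≤ 2 * r / c := by gcongr
  have hXs : 2 * r / c ≤ (2 * r / c) ^ s := by
    conv_lhs => rw [← Real.rpow_one (2 * r / c)]
    exact Real.rpow_le_rpow_of_exponent_ge hX0 hX.le (by linarith)
  have hXq := H.sqrt_le_rpow hX0 hX.le
  obtain ⟨i, t, ht, rfl⟩ := H.E_step hy
  obtain ⟨ht0, ht1⟩ := H.E_sub ht
  have hi := i.2
  rw [H.F_ss]
  set g : ℕ → ℝ := fun j => F μ (t + (((i : ℝ) - j) * R N ρ - r) / ρ)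
    (t + (((i : ℝ) - j) * R N ρ + r) / ρ) with hg
  have hg0 : ∀ j, 0 ≤ g j := fun j => F_nonneg _ _
  have hg1 : ∀ j, g j ≤ 1 := fun j => H.F_le_one _ _
  suffices hS : ∑ j ∈ Finset.range N, g j ≤ N * (2 * r / c) ^ s + e by
    rw [one_div, inv_mul_le_iff₀ hN0, mul_add, mul_div_cancel₀ _ hN0.ne']
    exact hS
  -- the scale
  obtain ⟨k, hk⟩ : ∃ k : ℕ, k = ⌈(r + ρ) / R N ρ⌉₊ - 1 := ⟨_, rfl⟩
  have hce : 0 < ⌈(r + ρ) / R N ρ⌉₊ := Nat.ceil_pos.2 (by positivity)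
  have hup : r + ρ ≤ (k + 1) * R N ρ := by
    have := Nat.le_ceil ((r + ρ) / R N ρ)
    have h' : (⌈(r + ρ) / R N ρ⌉₊ : ℝ) = k + 1 := by
      rw [hk]; push_cast [Nat.cast_sub (show 1 ≤ ⌈(r + ρ) / R N ρ⌉₊ by omega)]; ring
    rwa [h', div_le_iff₀ hR] at this
  have hlo : k * R N ρ < r + ρ := by
    have : k < ⌈(r + ρ) / R N ρ⌉₊ := by omega
    rwa [Nat.lt_ceil, lt_div_iff₀ hR] at this
  have hz : ∀ j, (i : ℕ) + k < j ∨ j + k < i → g j = 0 := by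
    intro j hj
    apply H.term_zero ht0 ht1
    rcases hj with hj | hj
    · right
      have : (i : ℝ) + k + 1 ≤ j := by exact_mod_cast hj
      nlinarith
    · left
      have : (j : ℝ) + k + 1 ≤ i := by exact_mod_cast hj
      nlinarith
  have hSb := sum_bound (N := N) g hg0 hg1 i k hz
  have hres : ∀ x : ℝ, 0 ≤ x → N * (x / ρ) ^ s = N * (N * x ^ s) := by
    intro x hx
    rw [Real.div_rpow hx h0.le, H.ρs]
    field_simp
  by_cases hk0 : k = 0
  · subst hk0
    have hS1 : ∑ j ∈ Finset.range N, g j ≤ g i := by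
      apply le_of_eq
      apply Finset.sum_eq_single_of_mem _ (Finset.mem_range.2 hi)
      intro j _ hj
      exact hz j (by omega)
    have e1 : g i = F μ (t - r / ρ) (t + r / ρ) := by
      simp only [hg]; congr 1 <;> ring
    have := ih t ht (r / ρ) (by positivity)
    rw [show 2 * (r / ρ) / c = (2 * r / c) / ρ by ring, Real.div_rpow hX0.le h0.le, H.ρs] at this
    have e2 : (2 * r / c) ^ s / (1 / (N : ℝ)) = N * (2 * r / c) ^ s := by field_simp
    linarith
  have hk1 : 1 ≤ k := by omega
  have hk1' : (1 : ℝ) ≤ k := by exact_mod_cast hk1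
  have hcard := card_bound (N := N) i k hk1
  have gl : k ≤ (i : ℕ) → g (i - k) = F μ (t - (r - k * R N ρ) / ρ) (t + (k * R N ρ + r) / ρ) := by
    intro h
    simp only [hg]; rw [Nat.cast_sub h]; congr 1 <;> ring
  have gr : g (i + k) = F μ (t - (k * R N ρ + r) / ρ) (t + (r - k * R N ρ) / ρ) := by
    simp only [hg]; push_cast; congr 1 <;> ring
  rcases lt_or_ge (k * R N ρ) r with hd | hd
  · by_cases hboth : k ≤ (i : ℕ) ∧ i + k < N
    · rw [if_pos hboth.1, if_pos hboth.2, gl hboth.1, gr] at hSb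
      have hd' : 0 < (r - k * R N ρ) / ρ := div_pos (by linarith) h0
      have h5 := H.F_add t ((r - k * R N ρ) / ρ) (t + (k * R N ρ + r) / ρ) (t - (k * R N ρ + r) / ρ)
      have h6 := ih t ht _ hd'
      have h7 := H.F_le_one (t - (r - k * R N ρ) / ρ) (t + (r - k * R N ρ) / ρ)
      set β := 2 * (r - k * R N ρ) / c with hβ
      have hβ0 : 0 < β := div_pos (by linarith) hc0
      have e1 : 2 * ((r - k * R N ρ) / ρ) / c = β / ρ := by rw [hβ]; ring
      rw [e1, Real.div_rpow hβ0.le h0.le, H.ρs] at h6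
      have e2 : β ^ s / (1 / (N : ℝ)) = N * β ^ s := by field_simp
      rw [e2] at h6
      have hX' : 2 * r / c = 2 * k * R N ρ / c + β := by rw [hβ]; ring
      have hb0 : 0 ≤ min (β ^ s) (1 / (N : ℝ)) := le_min (by positivity) (by positivity)
      have h8 := Hc k hk1 (by omega) _ hb0 (min_le_right _ _)
      have h9 : min (β ^ s) (1 / (N : ℝ)) ^ (1 / s) ≤ β := by
        calc _ ≤ (β ^ s) ^ (1 / s) := Real.rpow_le_rpow hb0 (min_le_left _ _) (by positivity)
          _ = β := by rw [← Real.rpow_mul hβ0.le, mul_one_div_cancel hs0.ne', Real.rpow_one]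
      have h10 : 2 * k / N + min (β ^ s) (1 / (N : ℝ)) ≤ (2 * r / c) ^ s := by
        have : (2 * k / N + min (β ^ s) (1 / (N : ℝ))) ^ (1 / s) ≤ 2 * r / c := by linarith
        have := Real.rpow_le_rpow (by positivity) this hs0.le
        rwa [← Real.rpow_mul (by positivity), one_div_mul_cancel hs0.ne', Real.rpow_one] at this
      have h11 : F μ (t - (r - k * R N ρ) / ρ) (t + (r - k * R N ρ) / ρ)
          ≤ N * min (β ^ s) (1 / (N : ℝ)) + e := by
        rcases min_cases (β ^ s) (1 / (N : ℝ)) with ⟨h, _⟩ | ⟨h, _⟩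
        · rw [h]; exact h6
        · rw [h, mul_one_div_cancel hN0.ne']; linarith
      have h12 := mul_le_mul_of_nonneg_left h10 hN0.le
      rw [mul_add, mul_div_cancel₀ _ hN0.ne'] at h12
      linarith
    · have hS2 : ∑ j ∈ Finset.range N, g j ≤ 2 * k := by
        have := hg1 (i - k)
        have := hg1 (i + k)
        by_cases h1 : k ≤ (i : ℕ)
        · rw [if_pos h1, if_neg (by tauto)] at hSb; linarith
        · rw [if_neg h1] at hSb
          split_ifs at hSb <;> linarith
      have : 2 * k / N ≤ 2 * r / c := by
        refine le_trans ?_ hXN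
        rw [div_le_div_iff₀ hN0 (by positivity)]
        nlinarith
      rw [div_le_iff₀ hN0] at this
      nlinarith
  · have hkN : 2 * k ≤ N := by
      have : 2 * (k : ℝ) * R N ρ < (N + 1) * R N ρ := by nlinarith
      have := lt_of_mul_lt_mul_right this hR.le
      have : 2 * k < N + 1 := by exact_mod_cast this
      omega
    rcases Nat.lt_or_ge (2 * k) N with hlt | hge
    · have hS2 : ∑ j ∈ Finset.range N, g j ≤ 2 * k := by
        have := hg1 (i - k)
        have := hg1 (i + k)
        by_cases h1 : k ≤ (i : ℕ)
        · by_cases h2 : i + k < N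
          · rw [if_pos h1, if_pos h2, gl h1, gr] at hSb
            have hle : (r - k * R N ρ) / ρ ≤ 0 := div_nonpos_of_nonpos_of_nonneg (by linarith) h0.le
            have := H.F_disj (b := t + (r - k * R N ρ) / ρ) (c := t - (r - k * R N ρ) / ρ)
              (by linarith) (t - (k * R N ρ + r) / ρ) (t + (k * R N ρ + r) / ρ)
            linarith
          · rw [if_neg h2, if_pos h1] at hSb; linarith
        · rw [if_neg h1] at hSb
          split_ifs at hSb <;> linarith
      have hlt' : 2 * (k : ℝ) + 1 ≤ N := by exact_mod_cast hlt
      have h4 : 2 * k / N ≤ √(2 * r / c) := by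
        apply Real.le_sqrt_of_sq_le
        refine le_trans ?_ hXN
        rw [div_pow, div_le_div_iff₀ (by positivity) (by positivity)]
        have : 2 * k ^ 2 * R N ρ ≤ N * r := by
          have h5 : N * (k * R N ρ - ρ) ≤ N * r := by gcongr; linarith
          have h6 : k * R N ρ * 1 ≤ k * R N ρ * (N - 2 * k) := by gcongr; linarith
          have h7 : N * ρ ≤ k * R N ρ := by nlinarith
          linarith
        calc (2 * (k : ℝ)) ^ 2 * (N * R N ρ) = 2 * N * (2 * k ^ 2 * R N ρ) := by ring
          _ ≤ 2 * N * (N * r) := by gcongr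
          _ = _ := by ring
      have h5 := h4.trans hXq
      rw [div_le_iff₀ hN0] at h5
      linarith
    · have hNk : N = 2 * k := by omega
      have hNk' : (N : ℝ) = 2 * k := by exact_mod_cast hNk
      have hcard2 := card_bound2 (N := N) i k hi hNk
      set u := (k * R N ρ - r) / ρ with hu
      have hu1 : u ≤ 1 := by rw [hu, div_le_one h0]; linarith
      have hu0 : 0 < u := div_pos (by nlinarith) h0
      have hru : r = k * R N ρ - ρ * u := by rw [hu]; field_simp; ring
      have hneg : (r - k * R N ρ) / ρ = -u := by rw [hu]; ring
      rw [hneg] at gl gr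
      have hbig : 2 ≤ (k * R N ρ + r) / ρ := by
        rw [le_div_iff₀ h0]; nlinarith
      have hS2 : ∑ j ∈ Finset.range N, g j ≤ N - u / N := by
        by_cases h1 : k ≤ (i : ℕ)
        · rw [if_pos h1, if_neg (by omega), gl h1] at hSb
          have a1 := H.left_low hu0 hu1 (le_refl (-1))
          have a2 := H.F_disj (b := u) (c := t - -u) (by linarith) (-1) (t + (k * R N ρ + r) / ρ)
          linarith
        · rw [if_neg h1, if_pos (by omega), gr] at hSb
          have a1 := H.right_low hu0 hu1 (le_refl 2)
          have a2 := H.F_disj (b := t + -u) (c := 1 - u) (by linarith) (t - (k * R N ρ + r) / ρ) 2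
          linarith
      have h4 : 1 - u / N ^ 2 ≤ √(2 * r / c) := by
        apply Real.le_sqrt_of_sq_le
        refine le_trans ?_ hXN
        have e1 : 2 * r / (N * R N ρ) = 1 - 2 * u * ρ / (N * R N ρ) := by
          rw [hru, hNk']; field_simp
        have e2 : 2 * u * ρ / (N * R N ρ) ≤ 2 * u / (N * (N + 1)) := by
          rw [div_le_div_iff₀ (by positivity) (by positivity)]
          calc 2 * u * ρ * (N * (N + 1)) = 2 * u * N * (ρ * (N + 1)) := by ring
            _ ≤ 2 * u * N * R N ρ := by gcongr
            _ = _ := by ring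
        have e3 : (u / N ^ 2) ^ 2 + 2 * u / (N * (N + 1)) ≤ 2 * (u / N ^ 2) := by
          have : 2 * (u / N ^ 2) - ((u / N ^ 2) ^ 2 + 2 * u / (N * (N + 1)))
            = u * (2 * N ^ 2 - (N + 1) * u) / (N ^ 4 * (N + 1)) := by field_simp; ring
          have : 0 ≤ u * (2 * N ^ 2 - (N + 1) * u) / (N ^ 4 * (N + 1)) := by
            apply div_nonneg _ (by positivity)
            apply mul_nonneg hu0.le
            nlinarith
          linarith
        rw [e1]
        nlinarith
      have h5 := mul_le_mul_of_nonneg_left (h4.trans hXq) hN0.le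
      have e4 : N * (1 - u / N ^ 2) = N - u / N := by field_simp
      linarith

lemma up_bound (H : Setup N ρ s μ) {c : ℝ} (hc0 : 0 < c) (hcR : c ≤ N * R N ρ)
    (Hc : ∀ k : ℕ, 1 ≤ k → 2 * k + 1 ≤ N → ∀ b : ℝ, 0 ≤ b → b ≤ 1 / N →
      (2 * k / N + b) ^ (1 / s) ≤ 2 * k * R N ρ / c + b ^ (1 / s))
    {y r : ℝ} (hy : y ∈ cantorE N ρ) (hr : 0 < r) :
    F μ (y - r) (y + r) ≤ (2 * r / c) ^ s := by
  have hN := H.N2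
  have key : ∀ n : ℕ, ∀ t ∈ cantorE N ρ, ∀ r, 0 < r →
      F μ (t - r) (t + r) ≤ (2 * r / c) ^ s + (1 / (N : ℝ)) ^ n := by
    intro n
    induction n with
    | zero =>
      intro t _ r hr
      have := H.F_le_one (t - r) (t + r)
      have : 0 ≤ (2 * r / c) ^ s := by positivity
      simp; linarith
    | succ n ih =>
      intro t ht r hr
      have := H.up_step hc0 hcR Hc (e := (1 / (N : ℝ)) ^ n) (by positivity) ih ht hr
      rwa [pow_succ, mul_one_div]
  have hl : Tendsto (fun n : ℕ => (2 * r / c) ^ s + (1 / (N : ℝ)) ^ n) atTop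
      (𝓝 ((2 * r / c) ^ s + 0)) := by
    apply Tendsto.const_add
    refine _root_.tendsto_pow_atTop_nhds_zero_of_lt_one (by positivity) ?_
    rw [div_lt_one (by linarith)]; linarith
  rw [add_zero] at hl
  exact ge_of_tendsto' hl fun n => key n y hy r hr

/-- odd case -/
lemma Hc_odd (H : Setup N ρ s μ) : ∀ k : ℕ, 1 ≤ k → 2 * k + 1 ≤ N → ∀ b : ℝ, 0 ≤ b → b ≤ 1 / N →
      (2 * k / N + b) ^ (1 / s) ≤ 2 * k * R N ρ / 1 + b ^ (1 / s) := by
  intro k hk hkN b hb0 hb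
  have hN := H.N2
  have hs0 := H.s_pos
  have hk' : (1 : ℝ) ≤ k := by exact_mod_cast hk
  have hkN' : 2 * (k : ℝ) + 1 ≤ N := by exact_mod_cast hkN
  have hp : 1 ≤ 1 / s := by rw [le_div_iff₀ hs0]; linarith [H.s_half]
  have hcv := convexOn_rpow hp
  have hρ : (1 / (N : ℝ)) ^ (1 / s) = ρ := by
    rw [← H.ρs, ← Real.rpow_mul H.hρ0.le, mul_one_div_cancel hs0.ne', Real.rpow_one]
  set p := 1 / s
  have hA : 0 < 2 * (k : ℝ) / N := by positivity
  have hu1 : 2 * (k : ℝ) / N + 1 / N ≤ 1 := by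
    rw [← add_div, div_le_one (by linarith)]; exact hkN'
  have h1N : 1 / (N : ℝ) < 1 := by rw [div_lt_one (by linarith)]; linarith
  have hlt : b < 2 * (k : ℝ) / N + b := by linarith
  -- slopes
  have s1 : ((2 * (k : ℝ) / N + b) ^ p - b ^ p) / (2 * (k : ℝ) / N + b - b) ≤
      (1 ^ p - b ^ p) / (1 - b) := by
    apply hcv.secant_mono (a := b) (mem_Ici.2 hb0) (mem_Ici.2 (by linarith))
      (mem_Ici.2 (by linarith)) (by linarith) (by linarith) (by linarith)
  have s2 : (b ^ p - 1 ^ p) / (b - 1) ≤ ((1 / (N : ℝ)) ^ p - 1 ^ p) / (1 / (N : ℝ) - 1) := by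
    apply hcv.secant_mono (a := 1) (mem_Ici.2 (by linarith)) (mem_Ici.2 hb0)
      (mem_Ici.2 (by positivity)) (by linarith) (by linarith) hb
  have e1 : (b ^ p - 1 ^ p) / (b - 1) = (1 ^ p - b ^ p) / (1 - b) := by
    rw [← neg_sub, ← neg_sub 1 b, neg_div_neg_eq]
  have e2 : ((1 / (N : ℝ)) ^ p - 1 ^ p) / (1 / (N : ℝ) - 1) = N * R N ρ := by
    rw [hρ, Real.one_rpow]
    have := H.R_eq
    rw [div_eq_iff (by linarith)]
    field_simp
    linarith
  rw [e1, e2] at s2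
  have s3 := s1.trans s2
  rw [add_sub_cancel_right, div_le_iff₀ hA] at s3
  have : N * R N ρ * (2 * (k : ℝ) / N) = 2 * k * R N ρ := by field_simp
  rw [div_one]
  linarith

lemma conv_aux {p u v : ℝ} (hp : 2 ≤ p) (hv : 0 < v) (hvu : v < u) (huv : u + v ≤ 1) :
    u ^ p - v ^ p ≤ u - v := by
  have hcv := convexOn_rpow (p := p - 1) (by linarith)
  have s2 : (v ^ (p - 1) - 1 ^ (p - 1)) / (v - 1) ≤ (u ^ (p - 1) - 1 ^ (p - 1)) / (u - 1) := by
    apply hcv.secant_mono (a := 1) (mem_Ici.2 (by linarith)) (mem_Ici.2 hv.le)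
      (mem_Ici.2 (by linarith)) (by linarith) (by linarith) hvu.le
  rw [Real.one_rpow, ← neg_sub, ← neg_sub 1 v, neg_div_neg_eq, ← neg_sub 1 (u ^ (p - 1)),
    ← neg_sub 1 u, neg_div_neg_eq, div_le_div_iff₀ (by linarith) (by linarith)] at s2
  have eu : u ^ p = u * u ^ (p - 1) := by
    rw [Real.rpow_sub_one (by linarith), mul_div_cancel₀ _ (by linarith)]
  have ev : v ^ p = v * v ^ (p - 1) := by
    rw [Real.rpow_sub_one (by linarith), mul_div_cancel₀ _ (by linarith)]
  rw [eu, ev]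
  have hv1 : v ^ (p - 1) ≤ 1 := Real.rpow_le_one hv.le (by linarith) (by linarith)
  generalize u ^ (p - 1) = U at *
  generalize v ^ (p - 1) = V at *
  -- u (1-U) ≥ v (1-V)
  have h1 : v * (1 - v) ≤ u * (1 - u) := by nlinarith
  have h2 : v * (1 - V) * (1 - v) ≤ u * (1 - U) * (1 - v) := by
    have a1 : v * (1 - v) * (1 - V) ≤ u * (1 - u) * (1 - V) :=
      mul_le_mul_of_nonneg_right h1 (by linarith)
    have a2 := mul_le_mul_of_nonneg_left s2 (by linarith : (0 : ℝ) ≤ u)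
    nlinarith
  have := le_of_mul_le_mul_right h2 (by linarith)
  linarith

/-- even case -/
lemma Hc_even (H : Setup N ρ s μ) (hev : Even N) : ∀ k : ℕ, 1 ≤ k → 2 * k + 1 ≤ N →
    ∀ b : ℝ, 0 ≤ b → b ≤ 1 / N →
      (2 * k / N + b) ^ (1 / s) ≤ 2 * k * R N ρ / (N * R N ρ) + b ^ (1 / s) := by
  intro k hk hkN b hb0 hb
  have hN := H.N2
  have hs0 := H.s_pos
  have hR := H.R_pos
  have hk' : (1 : ℝ) ≤ k := by exact_mod_cast hk
  have hkN2 : 2 * k + 2 ≤ N := by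
    obtain ⟨m, hm⟩ := hev
    omega
  have hkN' : 2 * (k : ℝ) + 2 ≤ N := by exact_mod_cast hkN2
  have hp : 2 ≤ 1 / s := by rw [le_div_iff₀ hs0]; linarith [H.s_half]
  have hA : 0 < 2 * (k : ℝ) / N := by positivity
  have hA1 : 2 * (k : ℝ) / N + 2 * (1 / N) ≤ 1 := by
    rw [mul_one_div, ← add_div, div_le_one (by linarith)]; exact hkN'
  have e1 : 2 * k * R N ρ / (N * R N ρ) = 2 * (k : ℝ) / N := by field_simp
  rw [e1]
  rcases hb0.eq_or_lt with rfl | hb0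
  · rw [Real.zero_rpow (by linarith), add_zero]
    have h1 : 2 * (k : ℝ) / N ≤ 1 := by
      have : 0 ≤ 1 / (N : ℝ) := by positivity
      linarith
    conv_rhs => rw [← Real.rpow_one (2 * (k : ℝ) / N)]
    exact Real.rpow_le_rpow_of_exponent_ge hA h1 (by linarith)
  · have := conv_aux hp hb0 (show b < 2 * (k : ℝ) / N + b by linarith) (by linarith)
    linarith

end Setup

/-- compositions of the maps `f i` along a word -/
noncomputable def fw (N : ℕ) (ρ : ℝ) : List (Fin N) → ℝ → ℝ
  | [], x => x
  | i :: v, x => f N ρ i (fw N ρ v x)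

lemma fw_append (N : ℕ) (ρ : ℝ) (u v : List (Fin N)) (x : ℝ) :
    fw N ρ (u ++ v) x = fw N ρ u (fw N ρ v x) := by
  induction u with
  | nil => rfl
  | cons i u ih => simp [fw, ih]

lemma fw_fix {N : ℕ} {ρ : ℝ} (i : Fin N) {y : ℝ} (hf : f N ρ i y = y) (m : ℕ) (z : ℝ) :
    fw N ρ (List.replicate m i) z - y = ρ ^ m * (z - y) := by
  induction m with
  | zero => simp [fw]
  | succ m ih =>
    rw [List.replicate_succ, fw, pow_succ]
    conv_lhs => rw [← hf]
    unfold f at *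
    calc _ = ρ * (fw N ρ (List.replicate m i) z - y) := by ring
      _ = _ := by rw [ih]; ring

namespace Setup
variable {N : ℕ} {ρ s : ℝ} {μ : Measure ℝ}

lemma f_mem (H : Setup N ρ s μ) (i : Fin N) {x : ℝ} (hx : x ∈ Icc (0 : ℝ) 1) :
    f N ρ i x ∈ Icc (0 : ℝ) 1 := by
  obtain ⟨h1, h2⟩ := H.f_bd i.2
  have h0 := H.hρ0
  obtain ⟨h3, h4⟩ := hx
  unfold f
  constructor
  · positivity
  · nlinarith

lemma fw_mem (H : Setup N ρ s μ) (v : List (Fin N)) {x : ℝ} (hx : x ∈ Icc (0 : ℝ) 1) :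
    fw N ρ v x ∈ Icc (0 : ℝ) 1 := by
  induction v with
  | nil => exact hx
  | cons i v ih => exact H.f_mem i ih

lemma real_image_f (H : Setup N ρ s μ) (i : Fin N) {K : Set ℝ} (hK : K ⊆ Icc 0 1) :
    μ.real (f N ρ i '' K) = (1 / N) * μ.real K := by
  rw [H.ss_real]
  congr 1
  rw [Finset.sum_eq_single_of_mem (i : ℕ) (Finset.mem_range.2 i.2)]
  · rw [preimage_image_eq _ (H.f_emb i).injective]
  · intro j _ hj
    apply H.real_of_disj
    rintro x ⟨z, hz, hzx⟩ h0 h1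
    obtain ⟨hz0, hz1⟩ := hK hz
    have hR := H.R_pos
    have h3 := H.R3
    have hρ := H.hρ0
    unfold f at hzx
    rcases lt_or_gt_of_ne hj with h | h
    · have : (j : ℝ) + 1 ≤ (i : ℕ) := by exact_mod_cast h
      nlinarith
    · have : ((i : ℕ) : ℝ) + 1 ≤ j := by exact_mod_cast h
      nlinarith

lemma real_image_fw (H : Setup N ρ s μ) (v : List (Fin N)) {K : Set ℝ} (hK : K ⊆ Icc 0 1) :
    μ.real (fw N ρ v '' K) = (1 / (N : ℝ)) ^ v.length * μ.real K := by
  induction v with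
  | nil => simp [fw]
  | cons i v ih =>
    have : fw N ρ (i :: v) '' K = f N ρ i '' (fw N ρ v '' K) := by
      rw [image_image]; rfl
    rw [this, H.real_image_f, ih, List.length_cons, pow_succ]
    · ring
    · rintro _ ⟨x, hx, rfl⟩
      exact H.fw_mem v (hK hx)

lemma E_words (H : Setup N ρ s μ) (m : ℕ) {x : ℝ} (hx : x ∈ cantorE N ρ) :
    ∃ u : List.Vector (Fin N) m, ∃ t ∈ cantorE N ρ, x = fw N ρ u.1 t := by
  induction m generalizing x with
  | zero => exact ⟨List.Vector.nil, x, hx, rfl⟩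
  | succ m ih =>
    obtain ⟨i, t, ht, rfl⟩ := H.E_step hx
    obtain ⟨u, t', ht', rfl⟩ := ih ht
    exact ⟨List.Vector.cons i u, t', ht', by cases u; rfl⟩

lemma null_K (H : Setup N ρ s μ) (w : List (Fin N)) :
    μ {x | x ∈ cantorE N ρ ∧ ¬ ∃ v, ∃ z ∈ cantorE N ρ, x = fw N ρ v (fw N ρ w z)} = 0 := by
  have := H.prob
  have hN := H.N2
  set K := {x | x ∈ cantorE N ρ ∧ ¬ ∃ v, ∃ z ∈ cantorE N ρ, x = fw N ρ v (fw N ρ w z)} with hK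
  have hKI : K ⊆ Icc 0 1 := fun x hx => H.E_sub hx.1
  obtain ⟨w', hw'⟩ : ∃ w' : List.Vector (Fin N) w.length, w'.1 = w := ⟨⟨w, rfl⟩, rfl⟩
  have hsub : K ⊆ ⋃ u ∈ (Finset.univ : Finset (List.Vector (Fin N) w.length)).erase w',
      fw N ρ u.1 '' K := by
    rintro x ⟨hx, hx2⟩
    obtain ⟨u, t, ht, rfl⟩ := H.E_words w.length hx
    simp only [mem_iUnion]
    refine ⟨u, ?_, t, ⟨ht, ?_⟩, rfl⟩
    · rw [Finset.mem_erase]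
      refine ⟨?_, Finset.mem_univ _⟩
      intro hu
      exact hx2 ⟨[], t, ht, by rw [hu, hw']; rfl⟩
    · rintro ⟨v, z, hz, rfl⟩
      exact hx2 ⟨u.1 ++ v, z, hz, by rw [fw_append]⟩
  have h1 := (measureReal_mono (μ := μ) hsub (measure_ne_top _ _)).trans
    (measureReal_biUnion_finset_le _ _)
  have h2 : ∀ u ∈ (Finset.univ : Finset (List.Vector (Fin N) w.length)).erase w',
      μ.real (fw N ρ u.1 '' K) = (1 / (N : ℝ)) ^ w.length * μ.real K := by
    intro u _
    rw [H.real_image_fw _ hKI, u.2]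
  rw [Finset.sum_congr rfl h2, Finset.sum_const, Finset.card_erase_of_mem (Finset.mem_univ _),
    Finset.card_univ, card_vector, Fintype.card_fin, nsmul_eq_mul,
    Nat.cast_sub (Nat.one_le_pow _ _ (by have := H.hN; omega))] at h1
  have hp : (0 : ℝ) < (N : ℝ) ^ w.length := by positivity
  have h3 : ((N ^ w.length : ℕ) - (1 : ℕ) : ℝ) * ((1 / (N : ℝ)) ^ w.length * μ.real K)
      = μ.real K - (1 / (N : ℝ)) ^ w.length * μ.real K := by
    push_cast
    rw [one_div, inv_pow]
    field_simp
  rw [h3] at h1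
  have h4 : 0 < (1 / (N : ℝ)) ^ w.length := by positivity
  have h5 : μ.real K ≤ 0 := by
    by_contra hc
    push Not at hc
    have := mul_pos h4 hc
    linarith
  have h6 : μ.real K = 0 := le_antisymm h5 measureReal_nonneg
  rwa [measureReal_eq_zero_iff] at h6

lemma ae_visits (H : Setup N ρ s μ) : ∀ᵐ x ∂μ, x ∈ cantorE N ρ → ∀ w : List (Fin N), ∀ n0 : ℕ,
    ∃ v, n0 ≤ v.length ∧ ∃ z ∈ cantorE N ρ, x = fw N ρ v (fw N ρ w z) := by
  have hp := H.prob
  have : ∀ w : List (Fin N), ∀ᵐ x ∂μ, x ∈ cantorE N ρ → ∀ n0 : ℕ,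
      ∃ v, n0 ≤ v.length ∧ ∃ z ∈ cantorE N ρ, x = fw N ρ v (fw N ρ w z) := by
    intro w
    rw [ae_iff]
    set K := {x | x ∈ cantorE N ρ ∧ ¬ ∃ v, ∃ z ∈ cantorE N ρ, x = fw N ρ v (fw N ρ w z)} with hK
    have hKI : K ⊆ Icc 0 1 := fun x hx => H.E_sub hx.1
    have hK0 : μ K = 0 := H.null_K w
    have hnull : μ (⋃ u : List (Fin N), fw N ρ u '' K) = 0 := by
      rw [measure_iUnion_null_iff]
      intro u
      have := H.real_image_fw u hKI
      rw [measureReal_def (s := K), hK0] at this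
      simp only [ENNReal.toReal_zero, mul_zero] at this
      rwa [measureReal_eq_zero_iff] at this
    refine measure_mono_null ?_ hnull
    intro x hx
    simp only [mem_setOf_eq, Classical.not_imp, not_forall] at hx
    obtain ⟨hx, n0, hn⟩ := hx
    obtain ⟨u, t, ht, rfl⟩ := H.E_words n0 hx
    rw [mem_iUnion]
    refine ⟨u.1, t, ⟨ht, ?_⟩, rfl⟩
    rintro ⟨v, z, hz, rfl⟩
    apply hn
    refine ⟨u.1 ++ v, ?_, z, hz, by rw [fw_append]⟩
    have := u.2
    simp [this]
  filter_upwards [ae_all_iff.2 this] with x hx hE w using hx w hE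

lemma F_fw_ge (H : Setup N ρ s μ) (v : List (Fin N)) (z r : ℝ) :
    (1 / (N : ℝ)) ^ v.length * F μ (z - r) (z + r) ≤
      F μ (fw N ρ v z - ρ ^ v.length * r) (fw N ρ v z + ρ ^ v.length * r) := by
  induction v with
  | nil => simp [fw]
  | cons i v ih =>
    have h1 := H.F_ss_ge i.2 (fw N ρ v z) (ρ ^ (v.length + 1) * r)
    have e : ρ ^ (v.length + 1) * r / ρ = ρ ^ v.length * r := by
      have := H.hρ0.ne'
      rw [pow_succ]; field_simp
    rw [e] at h1
    refine le_trans ?_ h1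
    rw [List.length_cons, pow_succ, mul_comm _ (1 / (N : ℝ)), mul_assoc]
    gcongr

lemma F_fw_le (H : Setup N ρ s μ) (v : List (Fin N)) {z r : ℝ} (hz : z ∈ Icc (0 : ℝ) 1)
    (hr : 0 ≤ r) (hr1 : r ≤ 1) :
    F μ (fw N ρ v z - ρ ^ v.length * r) (fw N ρ v z + ρ ^ v.length * r) ≤
    (1 / (N : ℝ)) ^ v.length * F μ (z - r) (z + r) := by
  induction v with
  | nil => simp [fw]
  | cons i v ih =>
    have h0 := H.hρ0
    have hm := H.fw_mem v hz
    have h3 := H.R3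
    have hR := H.R_pos
    have hle : ρ ^ (v.length + 1) * r ≤ ρ := by
      have h1 : ρ ^ v.length ≤ 1 := pow_le_one₀ h0.le (by linarith [H.ρ4])
      have h2 : 0 ≤ ρ ^ v.length := by positivity
      have h4 : ρ ^ v.length * r ≤ 1 := by nlinarith
      rw [pow_succ]
      nlinarith
    have ep : (1/(N:ℝ))^(v.length+1) = (1/(N:ℝ)) * (1/(N:ℝ))^v.length := by rw [pow_succ, mul_comm]
    rw [fw, List.length_cons, H.F_ss, ep, mul_assoc]
    apply mul_le_mul_of_nonneg_left _ (by positivity)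
    rw [Finset.sum_eq_single_of_mem (i : ℕ) (Finset.mem_range.2 i.2)]
    · refine le_trans (le_of_eq ?_) ih
      have e : ρ ^ (v.length + 1) * r / ρ = ρ ^ v.length * r := by
        rw [pow_succ]; field_simp
      rw [← e]
      congr 1 <;> ring
    · intro j _ hj
      apply H.term_zero hm.1 hm.2
      rcases lt_or_gt_of_ne hj with h | h
      · left
        have : (j : ℝ) + 1 ≤ (i : ℕ) := by exact_mod_cast h
        nlinarith
      · right
        have : ((i : ℕ) : ℝ) + 1 ≤ j := by exact_mod_cast h
        nlinarith

lemma ρns (H : Setup N ρ s μ) (n : ℕ) : (ρ ^ n) ^ s = (1 / (N : ℝ)) ^ n := by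
  rw [← H.ρs, ← Real.rpow_natCast, ← Real.rpow_natCast, ← Real.rpow_mul H.hρ0.le,
    ← Real.rpow_mul H.hρ0.le, mul_comm]

lemma freq (H : Setup N ρ s μ) {r0 : ℝ} (hr0 : 0 < r0) {P : ℝ → Prop}
    (h : ∀ n0 : ℕ, ∃ n ≥ n0, P (ρ ^ n * r0)) : ∃ᶠ r in 𝓝[>] (0 : ℝ), P r := by
  have h0 := H.hρ0
  have ht : Tendsto (fun n : ℕ => ρ ^ n * r0) atTop (𝓝[>] 0) := by
    apply tendsto_nhdsWithin_of_tendsto_nhds_of_eventually_within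
    · have := (_root_.tendsto_pow_atTop_nhds_zero_of_lt_one h0.le
        (by linarith [H.ρ4] : ρ < 1)).mul_const r0
      simpa using this
    · exact Eventually.of_forall fun n => mem_Ioi.2 (by positivity)
  exact ht.frequently (frequently_atTop.2 h)

lemma low_visit (H : Setup N ρ s μ) {x : ℝ}
    (hx : ∀ w : List (Fin N), ∀ n0 : ℕ,
      ∃ v, n0 ≤ v.length ∧ ∃ z ∈ cantorE N ρ, x = fw N ρ v (fw N ρ w z)) (m : ℕ) :
    ∃ᶠ r in 𝓝[>] (0 : ℝ), F μ (x - r) (x + r) / (2 * r) ^ s ≤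
      (1 / N) / (2 * (R N ρ - ρ ^ (m + 1))) ^ s := by
  have h0 := H.hρ0
  have h3 := H.R3
  have hN := H.N2
  have hN' := H.hN
  have hR := H.R_pos
  have hR1 := H.R_le
  have hpm : ρ ^ (m + 1) ≤ ρ := by
    rw [pow_succ]
    have : ρ ^ m ≤ 1 := pow_le_one₀ h0.le (by linarith [H.ρ4])
    nlinarith
  have hpm0 : 0 < ρ ^ (m + 1) := by positivity
  have hr0 : 0 < R N ρ - ρ ^ (m + 1) := by linarith
  apply H.freq hr0
  intro n0
  let i0 : Fin N := ⟨0, by omega⟩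
  obtain ⟨v, hv, z, hz, rfl⟩ := hx (List.replicate (m + 1) i0) n0
  refine ⟨v.length, hv, ?_⟩
  have hz' := H.E_sub hz
  have hfix : f N ρ i0 0 = 0 := by simp [f, i0]
  have hI := H.fw_mem (List.replicate (m + 1) i0) (show z ∈ Icc (0 : ℝ) 1 from hz')
  have h1 := H.F_fw_le v hI hr0.le (by linarith)
  have h2 : F μ (fw N ρ (List.replicate (m + 1) i0) z - (R N ρ - ρ ^ (m + 1)))
      (fw N ρ (List.replicate (m + 1) i0) z + (R N ρ - ρ ^ (m + 1))) ≤ 1 / N := by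
    rw [List.replicate_succ, fw, H.F_ss]
    have ht := fw_fix i0 hfix m z
    rw [sub_zero, sub_zero] at ht
    rw [ht]
    have htI : ρ ^ m * z ≤ ρ ^ m := by
      have : 0 ≤ ρ ^ m := by positivity
      nlinarith [hz'.2]
    rw [Finset.sum_eq_single_of_mem 0 (Finset.mem_range.2 (by omega))]
    · have := H.F_le_one (ρ ^ m * z + ((((i0 : ℕ) : ℝ) - (0 : ℕ)) * R N ρ - (R N ρ - ρ ^ (m + 1))) / ρ)
        (ρ ^ m * z + ((((i0 : ℕ) : ℝ) - (0 : ℕ)) * R N ρ + (R N ρ - ρ ^ (m + 1))) / ρ)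
      have h' : 0 ≤ 1 / (N : ℝ) := by positivity
      nlinarith
    · intro j _ hj
      apply H.F_left
      have hj1 : (1 : ℝ) ≤ j := by exact_mod_cast Nat.one_le_iff_ne_zero.2 hj
      have : ((((i0 : ℕ) : ℝ) - (j : ℕ)) * R N ρ + (R N ρ - ρ ^ (m + 1))) / ρ ≤ - ρ ^ m := by
        rw [div_le_iff₀ h0]
        have : ((i0 : ℕ) : ℝ) = 0 := by simp [i0]
        rw [this, pow_succ]
        nlinarith
      linarith
  have hn : (0 : ℝ) < (1 / (N : ℝ)) ^ v.length := by positivity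
  have e : (2 * (ρ ^ v.length * (R N ρ - ρ ^ (m + 1)))) ^ s
      = (1 / (N : ℝ)) ^ v.length * (2 * (R N ρ - ρ ^ (m + 1))) ^ s := by
    rw [← H.ρns, ← Real.mul_rpow (by positivity) (by linarith)]
    congr 1; ring
  have hD : 0 < (2 * (R N ρ - ρ ^ (m + 1))) ^ s := Real.rpow_pos_of_pos (by linarith) _
  rw [e, div_le_div_iff₀ (by positivity) hD]
  have h5 := h1.trans (mul_le_mul_of_nonneg_left h2 hn.le)
  calc _ ≤ (1 / (N : ℝ)) ^ v.length * (1 / N) * (2 * (R N ρ - ρ ^ (m + 1))) ^ s := by gcongr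
    _ = _ := by ring

lemma up_visit (H : Setup N ρ s μ) {x : ℝ}
    (hx : ∀ w : List (Fin N), ∀ n0 : ℕ,
      ∃ v, n0 ≤ v.length ∧ ∃ z ∈ cantorE N ρ, x = fw N ρ v (fw N ρ w z)) (m : ℕ)
    {c y : ℝ} (hc : 0 < c) (hyl : y - c / 2 ≤ 0) (hyr : 1 ≤ y + c / 2)
    {w : List (Fin N)} (hw : ∀ z ∈ Icc (0 : ℝ) 1, |fw N ρ w z - y| ≤ ρ ^ m) :
    ∃ᶠ r in 𝓝[>] (0 : ℝ), 1 / (c + 4 * ρ ^ m) ^ s ≤ F μ (x - r) (x + r) / (2 * r) ^ s := by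
  have h0 := H.hρ0
  have hN := H.N2
  have hpm : 0 < ρ ^ m := by positivity
  have hr0 : 0 < c / 2 + 2 * ρ ^ m := by linarith
  apply H.freq hr0
  intro n0
  obtain ⟨v, hv, z, hz, rfl⟩ := hx w n0
  refine ⟨v.length, hv, ?_⟩
  have h1 := H.F_fw_ge v (fw N ρ w z) (c / 2 + 2 * ρ ^ m)
  have h2 := abs_le.1 (hw z (H.E_sub hz))
  rw [H.F_full (by linarith) (by linarith), mul_one] at h1
  have hn : (0 : ℝ) < (1 / (N : ℝ)) ^ v.length := by positivity
  have e : (2 * (ρ ^ v.length * (c / 2 + 2 * ρ ^ m))) ^ s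
      = (1 / (N : ℝ)) ^ v.length * (c + 4 * ρ ^ m) ^ s := by
    rw [← H.ρns, ← Real.mul_rpow (by positivity) (by linarith)]
    congr 1; ring
  have hD : 0 < (c + 4 * ρ ^ m) ^ s := Real.rpow_pos_of_pos (by linarith) _
  rw [e, div_le_div_iff₀ hD (by positivity), one_mul]
  gcongr

lemma densities (H : Setup N ρ s μ) {x : ℝ} (hE : x ∈ cantorE N ρ)
    (hx : ∀ w : List (Fin N), ∀ n0 : ℕ,
      ∃ v, n0 ≤ v.length ∧ ∃ z ∈ cantorE N ρ, x = fw N ρ v (fw N ρ w z))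
    {c y : ℝ} (hc : 0 < c) (hyl : y - c / 2 ≤ 0) (hyr : 1 ≤ y + c / 2)
    (hw : ∀ m : ℕ, ∃ w : List (Fin N), ∀ z ∈ Icc (0 : ℝ) 1, |fw N ρ w z - y| ≤ ρ ^ m)
    (hup : ∀ r, 0 < r → F μ (x - r) (x + r) ≤ (2 * r / c) ^ s) :
    lowerDensity μ s x = (2 * R N ρ / ρ) ^ (-s) ∧ upperDensity μ s x = c ^ (-s) := by
  have h0 := H.hρ0
  have hN := H.N2
  have hR := H.R_pos
  have h3 := H.R3
  set G : ℝ → ℝ := fun r => (μ (Ioo (x - r) (x + r))).toReal / (2 * r) ^ s with hG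
  have hGF : ∀ r, G r = F μ (x - r) (x + r) / (2 * r) ^ s := fun r => rfl
  have eL : (2 * R N ρ / ρ) ^ (-s) = (1 / N) / (2 * R N ρ) ^ s := by
    rw [Real.rpow_neg (by positivity), Real.div_rpow (by positivity) h0.le, H.ρs, inv_div]
  have hpos : ∀ᶠ r in 𝓝[>] (0 : ℝ), 0 < r ∧ r ≤ 1 := by
    filter_upwards [Ioc_mem_nhdsGT (zero_lt_one (α := ℝ))] with r hr using hr
  have evU : ∀ᶠ r in 𝓝[>] (0 : ℝ), G r ≤ c ^ (-s) := by
    filter_upwards [hpos] with r hr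
    have hr0 := hr.1
    rw [hGF, div_le_iff₀ (by positivity), Real.rpow_neg hc.le, inv_mul_eq_div,
      ← Real.div_rpow (by positivity) hc.le]
    exact hup r hr.1
  have evL : ∀ᶠ r in 𝓝[>] (0 : ℝ), (2 * R N ρ / ρ) ^ (-s) ≤ G r := by
    filter_upwards [hpos] with r hr
    have hr0 := hr.1
    rw [hGF, le_div_iff₀ (by positivity), eL]
    refine le_trans (le_of_eq ?_) (H.low_bound hE hr.1 hr.2)
    rw [div_mul_eq_mul_div, mul_div_assoc, ← Real.div_rpow (by positivity) (by positivity)]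
    congr 2
    field_simp
  have bU : IsBoundedUnder (· ≤ ·) (𝓝[>] (0 : ℝ)) G := isBoundedUnder_of_eventually_le evU
  have bL : IsBoundedUnder (· ≥ ·) (𝓝[>] (0 : ℝ)) G := isBoundedUnder_of_eventually_ge evL
  have hlim0 : Tendsto (fun m : ℕ => ρ ^ m) atTop (𝓝 0) :=
    _root_.tendsto_pow_atTop_nhds_zero_of_lt_one h0.le (by linarith [H.ρ4] : ρ < 1)
  constructor
  · apply le_antisymm
    · have hm : ∀ m : ℕ, lowerDensity μ s x ≤ (1 / N) / (2 * (R N ρ - ρ ^ (m + 1))) ^ s := fun m =>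
        liminf_le_of_frequently_le (H.low_visit hx m) bL
      have ht : Tendsto (fun m : ℕ => (1 / (N : ℝ)) / (2 * (R N ρ - ρ ^ (m + 1))) ^ s) atTop
          (𝓝 ((1 / (N : ℝ)) / (2 * (R N ρ - 0)) ^ s)) := by
        have hl1 := (tendsto_add_atTop_iff_nat 1).2 hlim0
        refine Tendsto.div tendsto_const_nhds ?_ ?_
        · exact ((hl1.const_sub (R N ρ)).const_mul 2).rpow_const (Or.inr H.s_pos.le)
        · rw [sub_zero]; positivity
      rw [sub_zero] at ht
      rw [eL]
      exact ge_of_tendsto' ht hm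
    · exact le_liminf_of_le bU.isCoboundedUnder_ge evL
  · apply le_antisymm
    · exact limsup_le_of_le bL.isCoboundedUnder_le evU
    · have hm : ∀ m : ℕ, 1 / (c + 4 * ρ ^ m) ^ s ≤ upperDensity μ s x := fun m => by
        obtain ⟨w, hw⟩ := hw m
        exact le_limsup_of_frequently_le (H.up_visit hx m hc hyl hyr hw) bU
      have ht : Tendsto (fun m : ℕ => 1 / (c + 4 * ρ ^ m) ^ s) atTop
          (𝓝 (1 / (c + 4 * 0) ^ s)) := by
        refine Tendsto.div tendsto_const_nhds ?_ ?_
        · exact ((hlim0.const_mul 4).const_add c).rpow_const (Or.inr H.s_pos.le)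
        · rw [mul_zero, add_zero]; positivity
      rw [mul_zero, add_zero] at ht
      rw [Real.rpow_neg hc.le, ← one_div]
      exact le_of_tendsto' ht hm

end Setup

/-- Theorem 1 (iii): typical values of the lower and upper `s`-densities. -/
theorem ae_density_values (N : ℕ) (hN : 2 ≤ N) (ρ : ℝ) (hρ0 : 0 < ρ)
    (hρ1 : ρ ≤ 1 / (N : ℝ) ^ 2) (s : ℝ) (hs : s = -Real.log N / Real.log ρ)
    (μ : Measure ℝ) (hprob : IsProbabilityMeasure μ) (hss : IsSelfSimilar N ρ μ) :
    ∀ᵐ x ∂μ, x ∈ cantorE N ρ →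
      lowerDensity μ s x = (2 * R N ρ / ρ) ^ (-s) ∧
      upperDensity μ s x = if Odd N then 1 else ((N : ℝ) * R N ρ) ^ (-s) := by
  have H : Setup N ρ s μ := ⟨hN, hρ0, hρ1, hs, hprob, hss⟩
  have hR := H.R_pos
  have hRe := H.R_eq
  have hNR := H.NR
  have h3 := H.R3
  have hN2 := H.N2
  filter_upwards [H.ae_visits] with x hx hE
  have hx := hx hE
  by_cases hodd : Odd N
  · rw [if_pos hodd]
    obtain ⟨k, hk⟩ := hodd
    have hk' : (N : ℝ) = 2 * k + 1 := by exact_mod_cast hk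
    have hfix : f N ρ (⟨k, by omega⟩ : Fin N) (1 / 2) = 1 / 2 := by
      unfold f
      rw [hk'] at hRe
      simp only
      nlinarith
    have := H.densities hE hx (c := 1) (y := 1 / 2) one_pos (by norm_num) (by norm_num)
      (fun m => ⟨List.replicate m ⟨k, by omega⟩, fun z hz => by
        rw [fw_fix _ hfix, abs_mul, abs_of_pos (by positivity : 0 < ρ ^ m)]
        have : |z - 1 / 2| ≤ 1 := abs_le.2 ⟨by linarith [hz.1], by linarith [hz.2]⟩
        exact mul_le_of_le_one_right (by positivity) this⟩)
      (fun r hr => H.up_bound one_pos hNR H.Hc_odd hE hr)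
    rwa [Real.one_rpow] at this
  · rw [if_neg hodd]
    have hev : Even N := Nat.not_odd_iff_even.1 hodd
    obtain ⟨k, hk⟩ := id hev
    have hk' : (N : ℝ) = k + k := by exact_mod_cast hk
    have hk1 : 1 ≤ k := by omega
    have hfix : f N ρ (⟨N - 1, by omega⟩ : Fin N) 1 = 1 := by
      unfold f
      simp only
      rw [Nat.cast_sub (by omega)]
      push_cast
      linarith
    have hcast : (((k - 1 : ℕ)) : ℝ) = k - 1 := by rw [Nat.cast_sub hk1]; simp
    refine H.densities hE hx (c := N * R N ρ) (y := f N ρ (k - 1) 1) (by positivity) ?_ ?_ ?_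
      (fun r hr => H.up_bound (by positivity) le_rfl (H.Hc_even hev) hE hr)
    · unfold f
      rw [hcast, hk']
      linarith
    · unfold f
      rw [hcast]
      rw [hk'] at hRe
      rw [hk']
      linarith
    · intro m
      refine ⟨⟨k - 1, by omega⟩ :: List.replicate m ⟨N - 1, by omega⟩, fun z hz => ?_⟩
      have e : fw N ρ (⟨k - 1, by omega⟩ :: List.replicate m ⟨N - 1, by omega⟩) z
          - f N ρ (k - 1) 1 = ρ * (fw N ρ (List.replicate m ⟨N - 1, by omega⟩) z - 1) := by
        rw [fw]; unfold f; ring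
      rw [e, fw_fix _ hfix, abs_mul, abs_mul, abs_of_pos hρ0,
        abs_of_pos (by positivity : 0 < ρ ^ m)]
      have h1 : |z - 1| ≤ 1 := abs_le.2 ⟨by linarith [hz.1], by linarith [hz.2]⟩
      have h2 : ρ ^ m * |z - 1| ≤ ρ ^ m := mul_le_of_le_one_right (by positivity) h1
      have h4 : 0 ≤ ρ ^ m * |z - 1| := by positivity
      have := H.ρ4
      nlinarith

end HomogeneousCantorDensity
end
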